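/- For every u ∈ H¹(ℝ²), the quantity I(u) = (∫|∇u|² · ∫|u|²) / ∫|u|⁴ (when ∫|u|⁴ > 0) satisfies 2 I(u) ≥ ‖Q‖₂², where Q is the unique positive radial solution of -ΔQ + Q - Q³ = 0 in H¹(ℝ²). In particular, the Gagliardo-Nirenberg inequality ∫_{ℝ²}|u|⁴ dx ≤ (2/‖Q‖₂²) ∫_{ℝ²}|∇u|² dx · ∫_{ℝ²}|u|² dx holds for all u ∈ H¹(ℝ²). -/

import Mathlib

open MeasureTheory Real Filter

noncomputable section

abbrev E2 : Type := EuclideanSpace ℝ (Fin 2)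

/-- squared norm of the gradient -/
def gradSq (u : E2 → ℝ) (x : E2) : ℝ := ‖fderiv ℝ u x‖ ^ 2

/-- the Laplacian as the sum of second partial derivatives -/
def lap (u : E2 → ℝ) (x : E2) : ℝ :=
  ∑ i : Fin 2, fderiv ℝ (fun y => fderiv ℝ u y (EuclideanSpace.single i 1)) x
      (EuclideanSpace.single i 1)

/-- membership in H¹(ℝ²) together with L⁴ (which follows by Sobolev embedding) -/
def IsH1 (u : E2 → ℝ) : Prop :=
  Differentiable ℝ u ∧ Integrable (fun x => u x ^ 2) ∧
    Integrable (gradSq u) ∧ Integrable (fun x => u x ^ 4)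

/-- `Q` is the (unique) positive radial H¹ solution of `-ΔQ + Q - Q³ = 0` in ℝ² -/
def IsGroundState (Q : E2 → ℝ) : Prop :=
  ContDiff ℝ 2 Q ∧ (∀ x, 0 < Q x) ∧ (∀ x y : E2, ‖x‖ = ‖y‖ → Q x = Q y) ∧
    IsH1 Q ∧ ∀ x, -lap Q x + Q x - Q x ^ 3 = 0

/-- the space 𝓗 : H¹ functions with finite potential energy -/
def InH (V : E2 → ℝ) (u : E2 → ℝ) : Prop :=
  IsH1 u ∧ Integrable (fun x => V x * u x ^ 2)

/-- the Gross–Pitaevskii functional -/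
def Ea (V : E2 → ℝ) (a : ℝ) (u : E2 → ℝ) : ℝ :=
  (∫ x, gradSq u x) + (∫ x, V x * u x ^ 2) - a / 2 * (∫ x, u x ^ 4)

/-- a minimizer of the GP functional on the unit L² sphere of 𝓗 -/
def IsMinimizer (V : E2 → ℝ) (a : ℝ) (u : E2 → ℝ) : Prop :=
  InH V u ∧ (∫ x, u x ^ 2) = 1 ∧
    ∀ v, InH V v → (∫ x, v x ^ 2) = 1 → Ea V a u ≤ Ea V a v

/-- the GP ground-state energy, with values in ℝ ∪ {±∞} -/
def gpE (V : E2 → ℝ) (a : ℝ) : EReal :=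
  sInf {y : EReal | ∃ u, InH V u ∧ (∫ x, u x ^ 2) = 1 ∧ y = (Ea V a u : EReal)}

section
/-- inverse of the cubic `x ↦ 2/3 + x - x^3/3` on `[-1,1]`. -/
def cubX (y : ℝ) : ℝ := 2 * sin (arcsin ((3 * y - 2) / 2) / 3)

lemma cubX_continuous : Continuous cubX := by
  unfold cubX
  have := continuous_arcsin
  fun_prop

lemma cubX_zero : cubX 0 = -1 := by
  unfold cubX
  have h1 : ((3 * 0 - 2) / 2 : ℝ) = -1 := by norm_num
  rw [h1, arcsin_neg_one]
  have h2 : (-(π / 2) / 3 : ℝ) = -(π / 6) := by ring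
  rw [h2, sin_neg, sin_pi_div_six]; norm_num

lemma cubX_top : cubX (4/3) = 1 := by
  unfold cubX
  have h1 : ((3 * (4/3) - 2) / 2 : ℝ) = 1 := by norm_num
  rw [h1, arcsin_one]
  have h2 : ((π / 2) / 3 : ℝ) = (π / 6) := by ring
  rw [h2, sin_pi_div_six]; norm_num

lemma cubX_aux {y : ℝ} (h0 : 0 < y) (h1 : y < 4/3) :
    0 < 1 - cubX y ^ 2 ∧ HasDerivAt cubX (1 / (1 - cubX y ^ 2)) y := by
  set s := (3 * y - 2) / 2 with hs
  have hs1 : -1 < s := by rw [hs]; linarith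
  have hs2 : s < 1 := by rw [hs]; linarith
  set t := arcsin s / 3 with ht
  have hX : cubX y = 2 * sin t := rfl
  have hcos : cos (3 * t) = √(1 - s^2) := by
    have : 3 * t = arcsin s := by rw [ht]; ring
    rw [this, cos_arcsin]
  have hpos : 0 < √(1 - s^2) := by
    apply sqrt_pos.2; nlinarith
  have ht1 : -(π/2) < t := by
    have := neg_pi_div_two_le_arcsin s
    have := pi_pos
    rw [ht]; linarith
  have ht2 : t < (π/2) := by
    have := arcsin_le_pi_div_two s
    have := pi_pos
    rw [ht]; linarith
  have hct : 0 < cos t := cos_pos_of_mem_Ioo ⟨ht1, ht2⟩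
  have h3 : cos (3 * t) = cos t * (1 - (2 * sin t)^2) := by
    rw [cos_three_mul]
    have := sin_sq_add_cos_sq t
    linear_combination (4 * cos t) * this
  have hp : 0 < 1 - cubX y ^ 2 := by
    rw [hX]
    by_contra hcon
    push Not at hcon
    have : cos (3 * t) ≤ 0 := by rw [h3]; exact mul_nonpos_of_nonneg_of_nonpos hct.le hcon
    rw [hcos] at this
    linarith
  refine ⟨hp, ?_⟩
  have d1 : HasDerivAt (fun y : ℝ => (3 * y - 2) / 2) (3/2) y := by
    have := (((hasDerivAt_id y).const_mul 3).sub_const 2).div_const 2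
    simpa using this
  have d2 := (hasDerivAt_arcsin (x := s) (by linarith) (by linarith)).comp y d1
  have d3 := ((d2.div_const 3).sin).const_mul 2
  have : HasDerivAt cubX (2 * (cos t * (1 / √(1 - s ^ 2) * (3 / 2) / 3))) y := d3
  convert this using 1
  rw [hX] at hp ⊢
  have hh : √(1 - s^2) = cos t * (1 - (2 * sin t)^2) := by rw [← hcos, h3]
  rw [hh]
  field_simp

lemma cubX_sq_le (y : ℝ) (h0 : 0 ≤ y) (h1 : y ≤ 4/3) : 0 ≤ 1 - cubX y ^ 2 := by
  rcases eq_or_lt_of_le h0 with h | h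
  · rw [← h, cubX_zero]; norm_num
  rcases eq_or_lt_of_le h1 with h' | h'
  · rw [h', cubX_top]; norm_num
  exact (cubX_aux h h').1.le

/-- data of the radial profile -/
structure RadData (φ p : ℝ → ℝ) : Prop where
  hpc : Continuous p
  pos : ∀ r, 0 < φ r
  dφ : ∀ r, HasDerivAt φ (p r) r
  dp : ∀ r, 0 < r → HasDerivAt p (φ r - φ r ^ 3 - p r / r) r
  i2 : IntegrableOn (fun r => r * φ r ^ 2) (Set.Ioi 0)
  i4 : IntegrableOn (fun r => r * φ r ^ 4) (Set.Ioi 0)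
  ip : IntegrableOn (fun r => r * p r ^ 2) (Set.Ioi 0)

namespace RadData
variable {φ p : ℝ → ℝ}

lemma hφc (h : RadData φ p) : Continuous φ := continuous_iff_continuousAt.2 fun r => (h.dφ r).continuousAt

/-- no lower bound c/r for the energy density -/
lemma no_lower (h : RadData φ p) {c R : ℝ} (hc : 0 < c) (hR : 0 < R)
    (hb : ∀ r, R < r → c / r ≤ r * φ r ^ 2 + r * φ r ^ 4 + r * p r ^ 2) : False := by
  have hi : IntegrableOn (fun r => r * φ r ^ 2 + r * φ r ^ 4 + r * p r ^ 2) (Set.Ioi R) :=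
    ((h.i2.add h.i4).add h.ip).mono_set (Set.Ioi_subset_Ioi hR.le)
  have h2 : IntegrableOn (fun r : ℝ => c⁻¹ * (r * φ r ^ 2 + r * φ r ^ 4 + r * p r ^ 2)) (Set.Ioi R) :=
    hi.const_mul _
  apply not_integrableOn_Ioi_inv (a := R)
  refine Integrable.mono' h2 (measurable_inv.aestronglyMeasurable) ?_
  refine (ae_restrict_iff' measurableSet_Ioi).2 (Eventually.of_forall fun r hr => ?_)
  have hr0 : 0 < r := hR.trans hr
  rw [norm_of_nonneg (inv_nonneg.2 hr0.le)]
  have := hb r hr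
  rw [le_inv_mul_iff₀ hc]
  calc c * r⁻¹ = c / r := by ring
    _ ≤ _ := this

/-- Energy in the cube-root variable -/
lemma energy (h : RadData φ p) {r : ℝ} (hr : 0 < r) :
    φ r ^ 2 - φ r ^ 4 / 2 ≤ p r ^ 2 + 2 / 3 * (p r * φ r / r) + 2 / 9 * (φ r ^ 2 / r ^ 2) := by
  set e : ℝ → ℝ := fun τ => τ ^ 4 * p (τ^3) ^ 2 + 2/3 * (τ * p (τ^3) * φ (τ^3))
    + 2/9 * (φ (τ^3) ^ 2 / τ ^ 2) - τ ^ 4 * φ (τ^3) ^ 2 + τ ^ 4 * φ (τ^3) ^ 4 / 2 with he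
  have de : ∀ τ, 0 < τ → HasDerivAt e (-(2 * τ + 4 / (9 * τ ^ 5)) * τ ^ 2 * φ (τ^3)^2) τ := by
    intro τ hτ
    have d0 : HasDerivAt (fun τ : ℝ => τ ^ 3) (3 * τ ^ 2) τ := by simpa using hasDerivAt_pow 3 τ
    have dy : HasDerivAt (fun τ => φ (τ^3)) (p (τ^3) * (3 * τ^2)) τ := (h.dφ (τ^3)).comp τ d0
    have dz : HasDerivAt (fun τ => p (τ^3)) ((φ (τ^3) - φ (τ^3) ^ 3 - p (τ^3) / τ^3) * (3 * τ^2)) τ :=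
      (h.dp (τ^3) (by positivity)).comp τ d0
    have d4 : HasDerivAt (fun τ : ℝ => τ ^ 4) (4 * τ ^ 3) τ := by simpa using hasDerivAt_pow 4 τ
    have d2 : HasDerivAt (fun τ : ℝ => τ ^ 2) (2 * τ) τ := by simpa using hasDerivAt_pow 2 τ
    have d1 : HasDerivAt (fun τ : ℝ => τ) 1 τ := hasDerivAt_id τ
    have := ((((d4.mul (dz.pow 2)).add (((d1.mul dz).mul dy).const_mul (2/3))).add
      (((dy.pow 2).div d2 (by positivity)).const_mul (2/9))).sub (d4.mul (dy.pow 2))).add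
      ((d4.mul (dy.pow 4)).div_const 2)
    refine (this.congr_deriv ?_)
    simp only [Pi.mul_apply, Pi.pow_apply]
    field_simp
    ring
  have anti : AntitoneOn e (Set.Ioi 0) := by
    apply antitoneOn_of_deriv_nonpos (convex_Ioi 0)
    · exact fun τ hτ => (de τ hτ).continuousAt.continuousWithinAt
    · intro τ hτ; rw [interior_Ioi] at hτ
      exact (de τ hτ).differentiableAt.differentiableWithinAt
    · intro τ hτ; rw [interior_Ioi] at hτ
      rw [(de τ hτ).deriv]
      have : (0:ℝ) < τ := hτ
      have : 0 ≤ (2 * τ + 4 / (9 * τ ^ 5)) * τ ^ 2 * φ (τ^3)^2 := by positivity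
      linarith
  have nonneg : ∀ τ, 0 < τ → 0 ≤ e τ := by
    intro τ₀ h₀
    by_contra hcon
    push Not at hcon
    set c := - e τ₀ with hc
    have hcpos : 0 < c := by rw [hc]; linarith
    refine h.no_lower (c := c / 2) (R := max 1 τ₀ ^ 3) (by linarith) (by positivity) ?_
    intro r hr
    obtain ⟨τ, hτ, rfl⟩ : ∃ τ : ℝ, max 1 τ₀ < τ ∧ τ ^ 3 = r := by
      have hr0 : 0 ≤ r := le_trans (by positivity) hr.le
      refine ⟨r ^ (1/3:ℝ), ?_, ?_⟩
      · by_contra hh; push Not at hh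
        have := pow_le_pow_left₀ (rpow_nonneg hr0 (1/3:ℝ)) hh 3
        rw [← rpow_natCast, ← rpow_mul hr0] at this
        norm_num at this
        linarith [this]
      · rw [← rpow_natCast, ← rpow_mul hr0]; norm_num
    have h1 : 1 < τ := lt_of_le_of_lt (le_max_left _ _) hτ
    have h2 : τ₀ < τ := lt_of_le_of_lt (le_max_right _ _) hτ
    have hle : e τ ≤ -c := by
      have := anti (Set.mem_Ioi.2 h₀) (Set.mem_Ioi.2 (by linarith : 0 < τ)) h2.le
      rw [hc]; linarith
    simp only [he] at hle
    set y := φ (τ^3)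
    set z := p (τ^3)
    have hτ0 : 0 < τ := by linarith
    have q1 : 0 ≤ 2/9 * (y^2/τ^2) := by positivity
    have q2 : 0 ≤ τ^4 * z^2 := by positivity
    have q3 : 0 ≤ τ^4 * y^4/2 := by positivity
    have q4 : c ≤ τ^4 * y^2 - 2/3 * (τ * z * y) := by linarith
    have q5 : - (2/3 * (τ * z * y)) ≤ τ * (y^2 + z^2) := by nlinarith [sq_nonneg (y+z), sq_nonneg y, sq_nonneg z]
    have q6 : c ≤ 2 * τ^6 * (y^2+z^2) := by
      have t1 : τ ^ 4 ≤ τ^6 := pow_le_pow_right₀ h1.le (by norm_num)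
      have t2 : τ ≤ τ^6 := by simpa using pow_le_pow_right₀ h1.le (by norm_num : 1 ≤ 6)
      nlinarith [sq_nonneg y, sq_nonneg z, mul_nonneg (sub_nonneg.2 t1) (sq_nonneg y), mul_nonneg (sub_nonneg.2 t2) (add_nonneg (sq_nonneg y) (sq_nonneg z)), mul_nonneg (pow_nonneg hτ0.le 6) (sq_nonneg z)]
    rw [div_le_iff₀ (by positivity)]
    have : 0 ≤ τ^6 * y^4 := by positivity
    nlinarith
  have hr0 : 0 ≤ r := hr.le
  set τ := r ^ (1/3:ℝ) with hτ
  have hτ0 : 0 < τ := rpow_pos_of_pos hr _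
  have hτ3 : τ ^ 3 = r := by rw [hτ, ← rpow_natCast, ← rpow_mul hr0]; norm_num
  have := nonneg τ hτ0
  simp only [he, ← hτ3] at this ⊢
  set y := φ (τ^3)
  set z := p (τ^3)
  have key : p (τ^3) ^ 2 + 2 / 3 * (p (τ^3) * y / τ^3) + 2 / 9 * (y ^ 2 / (τ^3) ^ 2) - (y ^ 2 - y ^ 4 / 2)
    = (τ ^ 4 * z ^ 2 + 2 / 3 * (τ * z * y) + 2 / 9 * (y ^ 2 / τ ^ 2) - τ ^ 4 * y ^ 2 + τ ^ 4 * y ^ 4 / 2) / τ^4 := by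
    field_simp
    ring
  have : 0 ≤ p (τ^3) ^ 2 + 2 / 3 * (p (τ^3) * y / τ^3) + 2 / 9 * (y ^ 2 / (τ^3) ^ 2) - (y ^ 2 - y ^ 4 / 2) := by
    rw [key]; positivity
  linarith
end RadData
end

section
namespace RadData
variable {φ p : ℝ → ℝ}

def mas (φ : ℝ → ℝ) (r : ℝ) : ℝ := ∫ ρ in (0:ℝ)..r, ρ * φ ρ ^ 4
def tot (φ : ℝ → ℝ) : ℝ := ∫ ρ in Set.Ioi (0:ℝ), ρ * φ ρ ^ 4
def xx (φ : ℝ → ℝ) (r : ℝ) : ℝ := cubX (4 / 3 * mas φ r / tot φ)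

lemma mas_deriv (hc : Continuous φ) (r : ℝ) : HasDerivAt (mas φ) (r * φ r ^ 4) r := by
  have hcont : Continuous (fun ρ => ρ * φ ρ ^ 4) := by fun_prop
  exact intervalIntegral.integral_hasDerivAt_right (hcont.intervalIntegrable _ _)
    (hcont.stronglyMeasurableAtFilter _ _) hcont.continuousAt

lemma mas_mono (h : RadData φ p) : StrictMonoOn (mas φ) (Set.Ici 0) := by
  apply strictMonoOn_of_deriv_pos (convex_Ici 0)
  · exact fun r _ => (mas_deriv h.hφc r).continuousAt.continuousWithinAt
  · intro r hr
    rw [interior_Ici] at hr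
    rw [(mas_deriv h.hφc r).deriv]
    have := h.pos r
    have : (0:ℝ) < r := hr
    positivity

lemma mas_tendsto (h : RadData φ p) : Tendsto (mas φ) atTop (nhds (tot φ)) :=
  intervalIntegral_tendsto_integral_Ioi 0 h.i4 tendsto_id

lemma mas_zero : mas φ 0 = 0 := by simp [mas]

lemma mas_pos (h : RadData φ p) {r : ℝ} (hr : 0 < r) : 0 < mas φ r := by
  have := h.mas_mono (Set.mem_Ici.2 le_rfl) (Set.mem_Ici.2 hr.le) hr
  rwa [mas_zero] at this

lemma mas_lt (h : RadData φ p) {r : ℝ} (hr : 0 ≤ r) : mas φ r < tot φ := by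
  have h1 : mas φ r < mas φ (r+1) :=
    h.mas_mono (Set.mem_Ici.2 hr) (Set.mem_Ici.2 (by linarith)) (by linarith)
  refine h1.trans_le (ge_of_tendsto h.mas_tendsto ?_)
  filter_upwards [eventually_ge_atTop (r+1)] with s hs
  exact h.mas_mono.monotoneOn (Set.mem_Ici.2 (by linarith)) (Set.mem_Ici.2 (by linarith)) hs

lemma tot_pos (h : RadData φ p) : 0 < tot φ := by
  have := h.mas_lt le_rfl
  rwa [mas_zero] at this

lemma arg_mem (h : RadData φ p) {r : ℝ} (hr : 0 < r) :
    0 < 4 / 3 * mas φ r / tot φ ∧ 4 / 3 * mas φ r / tot φ < 4/3 := by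
  have h1 := h.mas_pos hr
  have h2 := h.mas_lt hr.le
  have h3 := h.tot_pos
  refine ⟨by positivity, ?_⟩
  rw [div_lt_iff₀ h3]; linarith

lemma xx_cont (h : RadData φ p) : Continuous (xx φ) := by
  have : Continuous (mas φ) := continuous_iff_continuousAt.2 fun r => (mas_deriv h.hφc r).continuousAt
  exact cubX_continuous.comp (by fun_prop)

lemma xx_zero : xx φ 0 = -1 := by
  simp [xx, mas_zero, cubX_zero]

lemma xx_tendsto (h : RadData φ p) : Tendsto (xx φ) atTop (nhds 1) := by
  have h1 : Tendsto (fun r => 4 / 3 * mas φ r / tot φ) atTop (nhds (4/3 * tot φ / tot φ)) :=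
    (h.mas_tendsto.const_mul _).div_const _
  have h2 : 4/3 * tot φ / tot φ = 4/3 := by
    have := h.tot_pos.ne'
    field_simp
  rw [h2] at h1
  have := (cubX_continuous.tendsto (4/3)).comp h1
  rwa [cubX_top] at this

lemma xx_sq (h : RadData φ p) {r : ℝ} (hr : 0 < r) : 0 < 1 - xx φ r ^ 2 :=
  (cubX_aux (h.arg_mem hr).1 (h.arg_mem hr).2).1

lemma xx_deriv (h : RadData φ p) {r : ℝ} (hr : 0 < r) :
    HasDerivAt (xx φ) (4 / (3 * tot φ) * (r * φ r ^ 4) / (1 - xx φ r ^ 2)) r := by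
  have d := (cubX_aux (h.arg_mem hr).1 (h.arg_mem hr).2).2
  have d1 : HasDerivAt (fun r => 4 / 3 * mas φ r / tot φ) (4 / 3 * (r * φ r ^ 4) / tot φ) r :=
    ((mas_deriv h.hφc r).const_mul _).div_const _
  refine (d.comp r d1).congr_deriv ?_
  have := h.tot_pos.ne'
  change 1 / (1 - xx φ r ^ 2) * _ = _
  have := (h.xx_sq hr).ne'
  field_simp

lemma pohozaev (h : RadData φ p) :
    tot φ = 2 * ∫ r in Set.Ioi (0:ℝ), r * φ r ^ 2 := by
  set G : ℝ → ℝ := fun r => r ^ 2 * (p r ^ 2 - φ r ^ 2 + φ r ^ 4 / 2) with hG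
  have hc := h.hφc
  have hpc := h.hpc
  have hφ := h.hφc
  have dG : ∀ r, 0 < r → HasDerivAt G (r * φ r ^ 4 - 2 * (r * φ r ^ 2)) r := by
    intro r hr
    have d2 : HasDerivAt (fun τ : ℝ => τ ^ 2) (2 * r) r := by simpa using hasDerivAt_pow 2 r
    have := d2.mul ((((h.dp r hr).pow 2).sub ((h.dφ r).pow 2)).add (((h.dφ r).pow 4).div_const 2))
    refine this.congr_deriv ?_
    simp only [Pi.pow_apply, Pi.add_apply, Pi.sub_apply]
    field_simp
    ring
  have hint : ∀ R, 0 ≤ R → G R = ∫ r in (0:ℝ)..R, (r * φ r ^ 4 - 2 * (r * φ r ^ 2)) := by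
    intro R hR
    rw [intervalIntegral.integral_eq_sub_of_hasDerivAt_of_le hR (f := G)]
    · simp [hG]
    · apply Continuous.continuousOn; fun_prop
    · exact fun r hr => dG r hr.1
    · apply Continuous.intervalIntegrable; fun_prop
  have hint2 : IntegrableOn (fun r => r * φ r ^ 4 - 2 * (r * φ r ^ 2)) (Set.Ioi 0) :=
    h.i4.sub (h.i2.const_mul 2)
  have hlim : Tendsto G atTop (nhds (∫ r in Set.Ioi (0:ℝ), (r * φ r ^ 4 - 2 * (r * φ r ^ 2)))) := by
    have := intervalIntegral_tendsto_integral_Ioi 0 hint2 tendsto_id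
    refine this.congr' ?_
    filter_upwards [eventually_ge_atTop 0] with R hR
    exact (hint R hR).symm
  have heq : (∫ r in Set.Ioi (0:ℝ), (r * φ r ^ 4 - 2 * (r * φ r ^ 2))) = tot φ - 2 * ∫ r in Set.Ioi (0:ℝ), r * φ r ^ 2 := by
    rw [integral_sub h.i4 (h.i2.const_mul 2), integral_const_mul]; rfl
  rw [heq] at hlim
  set l := tot φ - 2 * ∫ r in Set.Ioi (0:ℝ), r * φ r ^ 2 with hl
  by_contra hne
  have hl0 : l ≠ 0 := by rw [hl]; exact sub_ne_zero.2 hne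
  have hlim' := hlim.abs
  have hpos : 0 < |l| := abs_pos.2 hl0
  have hev := hlim'.eventually (lt_mem_nhds (by linarith : |l| / 2 < |l|))
  obtain ⟨R, hR⟩ := eventually_atTop.1 hev
  refine h.no_lower (c := |l| / 2) (R := max R 1) (by positivity) (by positivity) ?_
  intro r hr
  have hr1 : 1 < r := lt_of_le_of_lt (le_max_right _ _) hr
  have := hR r (le_of_lt (lt_of_le_of_lt (le_max_left _ _) hr))
  rw [div_le_iff₀ (by linarith)]
  refine this.le.trans ?_
  rw [hG]
  simp only [abs_mul]
  rw [abs_of_nonneg (sq_nonneg r)]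
  have : |p r ^ 2 - φ r ^ 2 + φ r ^ 4 / 2| ≤ p r ^ 2 + φ r ^ 2 + φ r ^ 4 := by
    rw [abs_le]; constructor <;> nlinarith [sq_nonneg (p r), sq_nonneg (φ r), sq_nonneg (φ r ^ 2)]
  nlinarith [mul_le_mul_of_nonneg_left this (sq_nonneg r)]

lemma contraction (h : RadData φ p) {r : ℝ} (hr : 0 < r) :
    9 * tot φ ^ 2 / 32 * (1 - xx φ r ^ 2) ^ 3 ≤ r ^ 2 * φ r ^ 6 := by
  set M := tot φ with hM
  have hM0 : 0 < M := h.tot_pos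
  obtain ⟨a, ha0, ha⟩ : ∃ a : ℝ, 0 < a ∧ a ^ 3 = 9 * M ^ 2 / 32 := by
    refine ⟨(9 * M ^ 2 / 32) ^ (1/3:ℝ), by positivity, ?_⟩
    rw [← rpow_natCast, ← rpow_mul (by positivity)]; norm_num
  set β := 4 * a ^ 2 / (3 * M) with hβ
  set D : ℝ → ℝ := fun τ => τ ^ 4 * φ (τ^3) ^ 4 - a ^ 2 * (1 - xx φ (τ^3) ^ 2) ^ 2 with hD
  set N : ℝ → ℝ := fun τ => 1 / (3 * τ ^ 2) + τ * p (τ^3) / φ (τ^3) + β * xx φ (τ^3) with hN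
  have d0 : ∀ τ : ℝ, HasDerivAt (fun τ : ℝ => τ ^ 3) (3 * τ ^ 2) τ := fun τ => by
    simpa using hasDerivAt_pow 3 τ
  have dy : ∀ τ : ℝ, 0 < τ → HasDerivAt (fun τ => φ (τ^3)) (p (τ^3) * (3 * τ^2)) τ :=
    fun τ _ => (h.dφ (τ^3)).comp τ (d0 τ)
  have dz : ∀ τ : ℝ, 0 < τ → HasDerivAt (fun τ => p (τ^3)) ((φ (τ^3) - φ (τ^3) ^ 3 - p (τ^3) / τ^3) * (3 * τ^2)) τ :=
    fun τ hτ => (h.dp (τ^3) (by positivity)).comp τ (d0 τ)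
  have dx : ∀ τ : ℝ, 0 < τ → HasDerivAt (fun τ => xx φ (τ^3))
      ((4 / (3 * M) * (τ^3 * φ (τ^3) ^ 4) / (1 - xx φ (τ^3) ^ 2)) * (3 * τ^2)) τ :=
    fun τ hτ => (h.xx_deriv (by positivity)).comp τ (d0 τ)
  have dD : ∀ τ : ℝ, 0 < τ → HasDerivAt D (12 * τ^5 * φ (τ^3) ^ 4 * N τ) τ := by
    intro τ hτ
    have d4 : HasDerivAt (fun τ : ℝ => τ ^ 4) (4 * τ ^ 3) τ := by simpa using hasDerivAt_pow 4 τ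
    have := (d4.mul ((dy τ hτ).pow 4)).sub (((((dx τ hτ).pow 2).const_sub 1).pow 2).const_mul (a^2))
    refine this.congr_deriv ?_
    have h1 := (h.pos (τ^3)).ne'
    have h2 := (h.xx_sq (r := τ^3) (by positivity)).ne'
    simp only [Pi.pow_apply, hN, hβ]
    field_simp
    ring
  have dN : ∀ τ : ℝ, 0 < τ → D τ < 0 → ∃ N', N' < 0 ∧ HasDerivAt N N' τ := by
    intro τ hτ hneg
    have h1 := (h.pos (τ^3))
    have h2 := (h.xx_sq (r := τ^3) (by positivity))
    have d2 : HasDerivAt (fun τ : ℝ => 3 * τ ^ 2) (3 * (2 * τ)) τ := by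
      simpa using (hasDerivAt_pow 2 τ).const_mul 3
    have d1 : HasDerivAt (fun τ : ℝ => τ) 1 τ := hasDerivAt_id τ
    have := (((hasDerivAt_const τ (1:ℝ)).div d2 (by positivity)).add
      ((d1.mul (dz τ hτ)).div (dy τ hτ) h1.ne')).add ((dx τ hτ).const_mul β)
    refine ⟨_, ?_, this⟩
    have he := h.energy (r := τ^3) (by positivity)
    simp only [hD] at hneg
    simp only [Pi.mul_apply]
    set y := φ (τ^3)
    set z := p (τ^3)
    set x := xx φ (τ^3)
    have hk : τ^2 * y^2 < a * (1 - x^2) := by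
      have : (τ^2*y^2)^2 < (a * (1-x^2))^2 := by nlinarith
      exact lt_of_pow_lt_pow_left₀ 2 (by positivity) this
    have e1 : β * (4 / (3 * M) * (τ ^ 3 * y ^ 4) / (1 - x ^ 2) * (3 * τ ^ 2)) = 3/2 * τ^3*y^2 * (τ^2*y^2/(a * (1-x^2))) := by
      rw [hβ]
      have hM2 : M^2 = 32 * a^3/9 := by rw [ha]; ring
      field_simp
      rw [hM2]; ring
    have e2 : τ^2*y^2/(a * (1-x^2)) < 1 := by rw [div_lt_one (by positivity)]; exact hk
    have e3 : (0 * (3 * τ ^ 2) - 1 * (3 * (2 * τ))) / (3 * τ ^ 2) ^ 2 +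
        ((1 * z + τ * ((y - y ^ 3 - z / τ ^ 3) * (3 * τ ^ 2))) * y - τ * z * (z * (3 * τ ^ 2))) / y ^ 2
        = 3 * τ^3 / y^2 * ((y^2 - y^4/2) - (z^2 + 2/3 * (z*y/τ^3) + 2/9 * (y^2/(τ^3)^2))) - 3/2 * τ^3*y^2 := by
      field_simp
      ring
    rw [e1, e3]
    have e4 : 3 * τ^3 / y^2 * ((y^2 - y^4/2) - (z^2 + 2/3 * (z*y/τ^3) + 2/9 * (y^2/(τ^3)^2))) ≤ 0 :=
      mul_nonpos_of_nonneg_of_nonpos (by positivity) (by linarith)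
    have e5 : 3/2 * τ^3*y^2 * (τ^2*y^2/(a * (1-x^2))) < 3/2 * τ^3*y^2 * 1 :=
      mul_lt_mul_of_pos_left e2 (by positivity)
    linarith
  have main : ∀ τ, 0 < τ → 0 ≤ D τ := by
    intro τ₁ h₁
    by_contra hneg
    push Not at hneg
    -- boundary
    have hxc := h.xx_cont
    have hφc := h.hφc
    have hDc : Continuous D := by rw [hD]; fun_prop
    set B : ℝ → ℝ := fun τ => a ^ 2 * (1 - xx φ (τ^3) ^ 2) ^ 2 with hB
    have hBc : Continuous B := by rw [hB]; fun_prop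
    have hB0 : B 0 = 0 := by simp [hB, xx_zero]
    have hBt : Tendsto B atTop (nhds 0) := by
      have h3 : Tendsto (fun τ : ℝ => τ^3) atTop atTop := tendsto_pow_atTop (by norm_num)
      have := (((((h.xx_tendsto.comp h3).pow 2).const_sub 1).pow 2).const_mul (a^2))
      simpa using this
    have hDB : ∀ τ, -B τ ≤ D τ := by
      intro τ
      simp only [hD, hB]
      have : 0 ≤ τ^4 * φ (τ^3)^4 := by positivity
      linarith
    have ev1 : ∀ᶠ τ in nhds 0, B τ < - D τ₁ := (hBc.tendsto 0).eventually (gt_mem_nhds (by rw [hB0]; linarith))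
    have ev2 : ∀ᶠ τ in atTop, B τ < - D τ₁ := hBt.eventually (gt_mem_nhds (by linarith))
    obtain ⟨ε, hε, hε'⟩ := Metric.eventually_nhds_iff.1 ev1
    obtain ⟨R, hR⟩ := eventually_atTop.1 ev2
    have hlow : ∀ τ, 0 < τ → D τ ≤ D τ₁ → ε/2 < τ ∧ τ < max R 1 + 1 := by
      intro τ hτ hle
      have := hDB τ
      constructor
      · by_contra hc
        push Not at hc
        have := @hε' τ (by rw [dist_zero_right, norm_of_nonneg hτ.le]; linarith)
        linarith
      · by_contra hc
        push Not at hc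
        have := hR τ (by linarith [le_max_left R 1])
        linarith
    have hmem1 := hlow τ₁ h₁ le_rfl
    obtain ⟨τ₀, hτ₀, hmin⟩ := (isCompact_Icc (a := ε/2) (b := max R 1 + 1)).exists_isMinOn
      ⟨τ₁, hmem1.1.le, hmem1.2.le⟩ hDc.continuousOn
    have hle : D τ₀ ≤ D τ₁ := hmin ⟨hmem1.1.le, hmem1.2.le⟩
    have h₀ : 0 < τ₀ := by linarith [hτ₀.1]
    have hglob : ∀ τ, 0 < τ → D τ₀ ≤ D τ := by
      intro τ hτ
      by_contra hc
      push Not at hc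
      have := hlow τ hτ (by linarith)
      have := hmin (a := τ) ⟨this.1.le, this.2.le⟩
      simp only [Set.mem_ofPred_eq] at this
      linarith
    have hloc : IsLocalMin D τ₀ := by
      filter_upwards [lt_mem_nhds h₀] with τ hτ using hglob τ hτ
    have hN0 : N τ₀ = 0 := by
      have := hloc.hasDerivAt_eq_zero (dD τ₀ h₀)
      have hp := h.pos (τ₀^3)
      rcases mul_eq_zero.1 this with h' | h'
      · exact absurd h' (by positivity)
      · exact h'
    obtain ⟨N', hN', hdN⟩ := dN τ₀ h₀ (by linarith)
    have hev : ∀ᶠ τ in nhdsWithin τ₀ (Set.Ioi τ₀), N τ < 0 := by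
      have hs := (hasDerivAt_iff_tendsto_slope.1 hdN)
      have hs' := hs.mono_left (nhdsWithin_mono τ₀ (fun x (hx : τ₀ < x) => (ne_of_gt hx : x ≠ τ₀)))
      filter_upwards [hs'.eventually (gt_mem_nhds hN'), self_mem_nhdsWithin] with τ h1 h2
      rw [slope_def_field, hN0, sub_zero] at h1
      have h3 : 0 < τ - τ₀ := sub_pos.2 h2
      by_contra hc
      push Not at hc
      have := div_nonneg hc h3.le
      linarith
    obtain ⟨τ₂, hτ₂, hall⟩ := (mem_nhdsGT_iff_exists_Ioo_subset).1 hev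
    have hτ₂' : τ₀ < τ₂ := hτ₂
    have hsa : StrictAntiOn D (Set.Icc τ₀ τ₂) := by
      apply strictAntiOn_of_deriv_neg (convex_Icc _ _) hDc.continuousOn
      intro τ hτ
      rw [interior_Icc] at hτ
      have hpos : 0 < τ := by linarith [hτ.1]
      rw [(dD τ hpos).deriv]
      have hp := h.pos (τ^3)
      exact mul_neg_of_pos_of_neg (by positivity) (hall hτ)
    have := hsa ⟨le_rfl, hτ₂'.le⟩ ⟨hτ₂'.le, le_rfl⟩ hτ₂'
    have := hglob τ₂ (by linarith)
    linarith
  have hr0 : 0 ≤ r := hr.le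
  set τ := r ^ (1/3:ℝ) with hτ
  have hτ0 : 0 < τ := rpow_pos_of_pos hr _
  have hτ3 : τ ^ 3 = r := by rw [hτ, ← rpow_natCast, ← rpow_mul hr0]; norm_num
  have := main τ hτ0
  simp only [hD, hτ3] at this
  have hx := h.xx_sq hr
  have hk : a * (1 - xx φ r ^ 2) ≤ τ^2 * φ r ^2 := by
    have : (a * (1 - xx φ r ^ 2))^2 ≤ (τ^2 * φ r ^2)^2 := by nlinarith
    exact le_of_sq_le_sq this (by positivity)
  have h3 := pow_le_pow_left₀ (by positivity) hk 3
  calc 9 * M ^ 2 / 32 * (1 - xx φ r ^ 2) ^ 3 = (a * (1 - xx φ r ^ 2)) ^ 3 := by rw [mul_pow, ha]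
    _ ≤ _ := h3
    _ = r ^ 2 * φ r ^ 6 := by rw [← hτ3]; ring
end RadData
end

section
lemma oneD_algebra {r F P w w' f f' x q x' q' μ γ : ℝ} (hr : 0 < r) (hF : 0 < F)
    (hμ : 0 < μ) (hγ : 0 < γ)
    (hf : f = F * w) (hf' : f' = F * w' + P * w) (hx : 0 < 1 - x ^ 2) (hq : 0 < 1 - q ^ 2)
    (hx' : x' = 4 / (3 * μ ^ 2) * (r * F ^ 4) / (1 - x ^ 2))
    (hq' : q' = 4 / (3 * γ ^ 2) * (r * f ^ 4) / (1 - q ^ 2))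
    (hcon : 9 * (μ ^ 2) ^ 2 / 32 * (1 - x ^ 2) ^ 3 ≤ r ^ 2 * F ^ 6) :
    ((F * P + r * P ^ 2 + r * F * (F - F ^ 3 - P / r)) * w ^ 2 + r * F * P * (2 * w * w'))
     - 3 * μ ^ 2 / 8 * ((-(2 * x * x') * (q - x) + (1 - x ^ 2) * (q' - x')) * w ^ 2
        + (1 - x ^ 2) * (q - x) * (2 * w * w'))
      ≤ r * f' ^ 2 + r * f ^ 2 - μ / γ * (r * f ^ 4) := by
  have hx'0 : 0 < x' := by rw [hx']; positivity
  have hxx : r * F ^ 4 = 3 * μ ^ 2 / 4 * (1 - x ^ 2) * x' := by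
    rw [hx']; field_simp
  have i2 : 3 * μ ^ 2 / 8 * ((1 - x^2)^2 / x') * w' ^ 2 ≤ r * F ^ 2 * w' ^ 2 := by
    apply mul_le_mul_of_nonneg_right _ (sq_nonneg _)
    rw [← mul_div_assoc, div_le_iff₀ hx'0, hx', ← mul_div_assoc, le_div_iff₀ hx]
    have : r * F ^ 2 * (4 / (3 * μ ^ 2) * (r * F ^ 4)) = 4 / (3 * μ^2) * (r ^ 2 * F ^ 6) := by ring
    rw [this]
    have h2 := mul_le_mul_of_nonneg_left hcon (by positivity : 0 ≤ 4 / (3 * μ^2))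
    refine le_trans (le_of_eq ?_) h2
    field_simp
    ring
  have i3 : 0 ≤ (1 - x^2)^2 / x' * w' ^ 2 + 2 * (1 - x^2) * (q - x) * w * w' + (q - x)^2 * w^2 * x' := by
    have : (1 - x^2)^2 / x' * w' ^ 2 + 2 * (1 - x^2) * (q - x) * w * w' + (q - x)^2 * w^2 * x'
      = ((1 - x^2) * w' + (q - x) * w * x') ^ 2 / x' := by field_simp; ring
    rw [this]; positivity
  have i4 : μ / γ * (r * f ^ 4) ≤ 3 * μ ^ 2 / 8 * w ^ 2 * ((1 - x^2) * q' + (1 - q^2) * x') := by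
    have e : 3 * μ ^ 2 / 8 * w ^ 2 * ((1 - x^2) * q' + (1 - q^2) * x') - μ / γ * (r * f ^ 4)
      = r * w ^ 2 / (2 * γ ^ 2 * ((1 - x^2) * (1 - q^2))) * ((1 - x^2) * μ * f ^ 2 - (1 - q ^2) * γ * F ^ 2) ^ 2 := by
      rw [hx', hq', hf]
      field_simp
      ring
    have : 0 ≤ 3 * μ ^ 2 / 8 * w ^ 2 * ((1 - x^2) * q' + (1 - q^2) * x') - μ / γ * (r * f ^ 4) := by
      rw [e]; positivity
    linarith
  have i3' := mul_nonneg (by positivity : 0 ≤ 3 * μ ^ 2 / 8) i3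
  have i1 : r * f' ^ 2 + r * f ^ 2 = r * F ^ 2 * w' ^ 2 + 3 * μ ^ 2 / 4 * (1 - x ^ 2) * x' * w ^ 2
      + ((F * P + r * P ^ 2 + r * F * (F - F ^ 3 - P / r)) * w ^ 2 + r * F * P * (2 * w * w')) := by
    rw [← hxx, hf, hf']
    field_simp
    ring
  rw [i1]
  nlinarith [i2, i3', i4]

namespace RadData
variable {φ p : ℝ → ℝ}

lemma oneD (h : RadData φ p) {f f' : ℝ → ℝ} {R : ℝ} (hR : 0 < R) (hfc : Continuous f)
    (hpos : ∀ r, 0 ≤ r → r < R → 0 < f r) (hfR : f R = 0)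
    (hd : ∀ r, 0 < r → r < R → HasDerivWithinAt f (f' r) (Set.Ioi r) r)
    (hi : IntervalIntegrable (fun r => r * f' r ^ 2) volume 0 R) :
    √(tot φ * ∫ r in (0:ℝ)..R, r * f r ^ 4) ≤
      (∫ r in (0:ℝ)..R, r * f' r ^ 2) + ∫ r in (0:ℝ)..R, r * f r ^ 2 := by
  change √(tot φ * mas f R) ≤ _
  have mono : StrictMonoOn (mas f) (Set.Icc 0 R) := by
    apply strictMonoOn_of_deriv_pos (convex_Icc 0 R)
    · exact fun r _ => (mas_deriv hfc r).continuousAt.continuousWithinAt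
    · intro r hr
      rw [interior_Icc] at hr
      rw [(mas_deriv hfc r).deriv]
      have := hpos r hr.1.le hr.2
      have := hr.1
      positivity
  have hC : 0 < mas f R := by
    have := mono ⟨le_rfl, hR.le⟩ ⟨hR.le, le_rfl⟩ hR
    rwa [mas_zero] at this
  set C := mas f R with hCdef
  have hM := h.tot_pos
  set μ := √(tot φ) with hμ
  set γ := √C with hγ
  have hμ0 : 0 < μ := sqrt_pos.2 hM
  have hγ0 : 0 < γ := sqrt_pos.2 hC
  have hμ2 : μ ^ 2 = tot φ := sq_sqrt hM.le
  have hγ2 : γ ^ 2 = C := sq_sqrt hC.le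
  set q : ℝ → ℝ := fun r => cubX (4 / 3 * mas f r / C) with hqdef
  have hmc : Continuous (mas f) := continuous_iff_continuousAt.2 fun r => (mas_deriv hfc r).continuousAt
  have hqc : Continuous q := cubX_continuous.comp (by fun_prop)
  have arg : ∀ r, 0 < r → r < R → 0 < 4 / 3 * mas f r / C ∧ 4 / 3 * mas f r / C < 4 / 3 := by
    intro r h0 h1
    have a1 := mono ⟨le_rfl, hR.le⟩ ⟨h0.le, h1.le⟩ h0
    have a2 := mono ⟨h0.le, h1.le⟩ ⟨hR.le, le_rfl⟩ h1
    rw [mas_zero] at a1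
    refine ⟨by positivity, ?_⟩
    rw [div_lt_iff₀ hC]; linarith
  have dq : ∀ r, 0 < r → r < R → HasDerivAt q (4 / (3 * C) * (r * f r ^ 4) / (1 - q r ^ 2)) r := by
    intro r h0 h1
    have aa := arg r h0 h1
    have d := (cubX_aux aa.1 aa.2)
    have d1 : HasDerivAt (fun r => 4 / 3 * mas f r / C) (4 / 3 * (r * f r ^ 4) / C) r :=
      ((mas_deriv hfc r).const_mul _).div_const _
    refine (d.2.comp r d1).congr_deriv ?_
    change 1 / (1 - q r ^ 2) * _ = _
    have : 1 - q r ^ 2 ≠ 0 := d.1.ne'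
    field_simp
  set w : ℝ → ℝ := fun r => f r / φ r with hw
  have hφc := h.hφc
  have hpc := h.hpc
  have hxc := h.xx_cont
  have hwc : Continuous w := by
    rw [hw]; exact hfc.div hφc (fun r => (h.pos r).ne')
  set G : ℝ → ℝ := fun r => r * φ r * p r * w r ^ 2
    - 3 * μ ^ 2 / 8 * ((1 - xx φ r ^ 2) * (q r - xx φ r) * w r ^ 2) with hG
  have hGc : Continuous G := by rw [hG]; fun_prop
  have hi2 : IntervalIntegrable (fun r => r * f r ^ 2) volume 0 R :=
    Continuous.intervalIntegrable (by fun_prop) _ _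
  have hi4 : IntervalIntegrable (fun r => μ / γ * (r * f r ^ 4)) volume 0 R :=
    Continuous.intervalIntegrable (by fun_prop) _ _
  have dwd : ∀ r, 0 < r → r < R → HasDerivWithinAt w ((f' r * φ r - f r * p r) / φ r ^ 2) (Set.Ioi r) r := by
    intro r h0 h1
    exact (hd r h0 h1).div (h.dφ r).hasDerivWithinAt (h.pos r).ne'
  have key := intervalIntegral.sub_le_integral_of_hasDeriv_right_of_le hR.le hGc.continuousOn
    (φ := fun r => r * f' r ^ 2 + r * f r ^ 2 - μ / γ * (r * f r ^ 4))
    (g' := fun r =>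
      ((φ r * p r + r * p r ^ 2 + r * φ r * (φ r - φ r ^ 3 - p r / r)) * w r ^ 2
        + r * φ r * p r * (2 * w r * ((f' r * φ r - f r * p r) / φ r ^ 2)))
     - 3 * μ ^ 2 / 8 * ((-(2 * xx φ r * (4 / (3 * μ ^ 2) * (r * φ r ^ 4) / (1 - xx φ r ^ 2))) * (q r - xx φ r)
        + (1 - xx φ r ^ 2) * ((4 / (3 * γ ^ 2) * (r * f r ^ 4) / (1 - q r ^ 2)) -
          (4 / (3 * μ ^ 2) * (r * φ r ^ 4) / (1 - xx φ r ^ 2)))) * w r ^ 2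
        + (1 - xx φ r ^ 2) * (q r - xx φ r) * (2 * w r * ((f' r * φ r - f r * p r) / φ r ^ 2))))
    (by
      intro r hr
      have D1 : HasDerivWithinAt (fun r : ℝ => r) 1 (Set.Ioi r) r := hasDerivWithinAt_id r _
      have Dw := dwd r hr.1 hr.2
      have Dφ := (h.dφ r).hasDerivWithinAt (s := Set.Ioi r)
      have Dp := (h.dp r hr.1).hasDerivWithinAt (s := Set.Ioi r)
      have Dx := (h.xx_deriv hr.1).hasDerivWithinAt (s := Set.Ioi r)
      have Dq := (dq r hr.1 hr.2).hasDerivWithinAt (s := Set.Ioi r)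
      rw [← hμ2] at Dx
      rw [← hγ2] at Dq
      have := (((D1.mul Dφ).mul Dp).mul (Dw.pow 2)).sub
        (((((Dx.pow 2).const_sub 1).mul (Dq.sub Dx)).mul (Dw.pow 2)).const_mul (3 * μ ^ 2 / 8))
      refine this.congr_deriv ?_
      simp only [Pi.mul_apply, Pi.pow_apply, Pi.sub_apply]
      ring)
    ((intervalIntegrable_iff_integrableOn_Icc_of_le hR.le).1 ((hi.add hi2).sub hi4))
    (by
      intro r hr
      have hF := h.pos r
      refine oneD_algebra (F := φ r) (P := p r) hr.1 hF hμ0 hγ0 ?_ ?_ (h.xx_sq hr.1)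
        (cubX_aux (arg r hr.1 hr.2).1 (arg r hr.1 hr.2).2).1 rfl rfl ?_
      · simp only [hw]; field_simp
      · simp only [hw]; field_simp; ring
      · rw [hμ2]; exact h.contraction hr.1)
  have hG0 : G 0 = 0 := by simp [hG, xx_zero]
  have hGR : G R = 0 := by simp [hG, hw, hfR]
  rw [hG0, hGR, intervalIntegral.integral_sub (hi.add hi2) hi4, intervalIntegral.integral_add hi hi2,
    intervalIntegral.integral_const_mul] at key
  have e1 : μ / γ * (∫ r in (0:ℝ)..R, r * f r ^ 4) = μ * γ := by
    change μ / γ * C = _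
    rw [← hγ2]; field_simp
  rw [e1] at key
  have e2 : √(tot φ * C) = μ * γ := by rw [sqrt_mul hM.le]
  rw [e2]; linarith
end RadData
end

section

lemma radial_integral (f : ℝ → ℝ) :
    ∫ x : E2, f ‖x‖ = 2 * π * ∫ r in Set.Ioi (0:ℝ), r * f r := by
  rw [integral_fun_norm_addHaar]
  have : (volume : Measure E2).real (Metric.ball 0 1) = π := by
    rw [Measure.real, EuclideanSpace.volume_ball_fin_two]
    simp [Real.pi_pos.le]
  rw [this]
  simp
  ring

lemma radial_integrable (f : ℝ → ℝ) :
    Integrable (fun x : E2 => f ‖x‖) ↔ IntegrableOn (fun r => r * f r) (Set.Ioi (0:ℝ)) := by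
  rw [integrable_fun_norm_addHaar]
  simp

lemma lap_radial {Q : E2 → ℝ} (hC : ContDiff ℝ 2 Q)
    (hrad : ∀ x y : E2, ‖x‖ = ‖y‖ → Q x = Q y) {r : ℝ} (hr : 0 < r)
    (p : ℝ → ℝ) (hp : p = fun r => fderiv ℝ Q (r • EuclideanSpace.single 0 1) (EuclideanSpace.single 0 1))
    (hd : ∀ r, HasDerivAt (fun r : ℝ => Q (r • EuclideanSpace.single 0 1)) (p r) r) :
    HasDerivAt p (lap Q (r • EuclideanSpace.single 0 1) - p r / r) r := by
  set e0 : E2 := EuclideanSpace.single 0 1 with he0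
  set e1 : E2 := EuclideanSpace.single 1 1 with he1
  have hQd : Differentiable ℝ Q := hC.differentiable (by norm_num)
  have hf1 : ContDiff ℝ 1 (fderiv ℝ Q) := hC.fderiv_right (by norm_num)
  have hG : ∀ v : E2, Differentiable ℝ (fun y => fderiv ℝ Q y v) := fun v =>
    (hf1.clm_apply contDiff_const).differentiable (by norm_num)
  have h0 : HasDerivAt p (fderiv ℝ (fun y => fderiv ℝ Q y e0) (r • e0) e0) r := by
    have h1 : HasDerivAt (fun s : ℝ => s • e0) e0 r := by
      simpa using (hasDerivAt_id r).smul_const e0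
    rw [hp]
    exact ((hG e0 (r • e0)).hasFDerivAt).comp_hasDerivAt r h1
  have hnorm : ∀ y : ℝ, ‖r • e0 + y • e1‖ = √(r^2 + y^2) := by
    intro y
    rw [EuclideanSpace.norm_eq]
    simp [he0, he1, Fin.sum_univ_two]
  have hpos : ∀ y : ℝ, 0 < r^2 + y^2 := fun y => by positivity
  have hline : ∀ y : ℝ, HasDerivAt (fun y : ℝ => r • e0 + y • e1) e1 y := by
    intro y
    simpa using ((hasDerivAt_id y).smul_const e1).const_add (r • e0)
  have hψ : ∀ y : ℝ, Q (r • e0 + y • e1) = Q (√(r^2+y^2) • e0) := by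
    intro y
    apply hrad
    rw [hnorm, norm_smul]
    simp [he0, abs_of_nonneg]
  have hψ' : ∀ y : ℝ, fderiv ℝ Q (r • e0 + y • e1) e1 = y * (p (√(r^2+y^2)) / √(r^2+y^2)) := by
    intro y
    have a1 : HasDerivAt (fun y : ℝ => Q (r • e0 + y • e1)) (fderiv ℝ Q (r • e0 + y • e1) e1) y :=
      ((hQd (r • e0 + y • e1)).hasFDerivAt).comp_hasDerivAt y (hline y)
    have a2 : HasDerivAt (fun y : ℝ => √(r^2+y^2)) (2 * y / (2 * √(r^2+y^2))) y := by
      have := ((hasDerivAt_pow 2 y).const_add (r^2)).sqrt (hpos y).ne'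
      simpa using this
    have a3 := (hd (√(r^2+y^2))).comp y a2
    have : (fun y : ℝ => Q (r • e0 + y • e1)) = (fun r : ℝ => Q (r • e0)) ∘ (fun y : ℝ => √(r^2+y^2)) := by
      funext y; exact hψ y
    rw [this] at a1
    rw [a1.unique a3]
    have := Real.sqrt_pos.2 (hpos y)
    field_simp
  have h2 : fderiv ℝ (fun y => fderiv ℝ Q y e1) (r • e0) e1 = p r / r := by
    have b1 : HasDerivAt (fun y : ℝ => fderiv ℝ Q (r • e0 + y • e1) e1)
        (fderiv ℝ (fun y => fderiv ℝ Q y e1) (r • e0 + (0:ℝ) • e1) e1) 0 := by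
      have hg := (hG e1 (r • e0 + (0:ℝ) • e1)).hasFDerivAt
      exact hg.comp_hasDerivAt (0:ℝ) (hline 0)
    have hpd : Differentiable ℝ p := by
      rw [hp]
      intro s
      have h1 : HasDerivAt (fun s : ℝ => s • e0) e0 s := by
        simpa using (hasDerivAt_id s).smul_const e0
      exact (((hG e0 (s • e0)).hasFDerivAt).comp_hasDerivAt s h1).differentiableAt
    have hsd : DifferentiableAt ℝ (fun y : ℝ => √(r^2+y^2)) 0 := by
      have h3 : DifferentiableAt ℝ (fun y : ℝ => r^2+y^2) 0 := by fun_prop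
      exact h3.sqrt (hpos 0).ne'
    have b2 : DifferentiableAt ℝ (fun y : ℝ => p (√(r^2+y^2)) / √(r^2+y^2)) 0 := by
      apply DifferentiableAt.div _ hsd (Real.sqrt_pos.2 (hpos 0)).ne'
      exact DifferentiableAt.comp (0:ℝ) (hpd _) hsd
    have b3 := (hasDerivAt_id (0:ℝ)).mul b2.hasDerivAt
    have : (fun y : ℝ => fderiv ℝ Q (r • e0 + y • e1) e1) = (id * fun y : ℝ => p (√(r^2+y^2)) / √(r^2+y^2)) := by
      funext y; exact hψ' y
    rw [this] at b1
    have b4 := b1.unique b3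
    simpa [Real.sqrt_sq hr.le] using b4
  have : lap Q (r • e0) - p r / r = fderiv ℝ (fun y => fderiv ℝ Q y e0) (r • e0) e0 := by
    rw [lap, Fin.sum_univ_two, ← he0, ← he1, h2]; ring
  rw [this]; exact h0

theorem groundState_data {Q : E2 → ℝ} (hQ : IsGroundState Q) :
    ∃ φ p : ℝ → ℝ, RadData φ p ∧ (∫ x, Q x ^ 4) = 2 * π * RadData.tot φ ∧
      (∫ x, Q x ^ 4) = 2 * ∫ x, Q x ^ 2 := by
  obtain ⟨hC, hpos, hrad, ⟨hQd, hi2, hig, hi4⟩, heq⟩ := hQ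
  set e0 : E2 := EuclideanSpace.single 0 1 with he0
  have he0n : ‖e0‖ = 1 := by simp [he0]
  set p : ℝ → ℝ := fun r => fderiv ℝ Q (r • e0) e0 with hp
  have hd : ∀ v : E2, ∀ r : ℝ, HasDerivAt (fun r : ℝ => Q (r • v)) (fderiv ℝ Q (r • v) v) r := by
    intro v r
    have h1 : HasDerivAt (fun s : ℝ => s • v) v r := by
      simpa using (hasDerivAt_id r).smul_const v
    exact ((hQd (r • v)).hasFDerivAt).comp_hasDerivAt r h1
  have hf1 : ContDiff ℝ 1 (fderiv ℝ Q) := hC.fderiv_right (by norm_num)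
  have hpc : Continuous p := by
    have := hf1.continuous
    rw [hp]; fun_prop
  have hQφ : ∀ x : E2, Q x = Q (‖x‖ • e0) := by
    intro x; apply hrad; rw [norm_smul, he0n]; simp
  have hpg : ∀ x : E2, p ‖x‖ ^ 2 ≤ gradSq Q x := by
    intro x
    obtain ⟨v, hv1, hv⟩ : ∃ v : E2, ‖v‖ = 1 ∧ ‖x‖ • v = x := by
      by_cases hx : x = 0
      · exact ⟨e0, he0n, by simp [hx]⟩
      · have := norm_ne_zero_iff.2 hx
        refine ⟨‖x‖⁻¹ • x, by rw [norm_smul]; simp [this], by rw [smul_smul]; simp [this]⟩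
    have h1 := hd v ‖x‖
    have : (fun r : ℝ => Q (r • v)) = fun r : ℝ => Q (r • e0) := by
      funext r; apply hrad; rw [norm_smul, norm_smul, hv1, he0n]
    rw [this, hv] at h1
    have h2 : p ‖x‖ = fderiv ℝ Q x v := (hd e0 ‖x‖).unique h1
    rw [h2, gradSq]
    have h3 := (fderiv ℝ Q x).le_opNorm v
    rw [hv1, mul_one, Real.norm_eq_abs] at h3
    rw [← sq_abs]
    gcongr
  have hR : RadData (fun r => Q (r • e0)) p := by
    refine ⟨hpc, fun r => hpos _, hd e0, ?_, ?_, ?_, ?_⟩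
    · intro r hr
      have := lap_radial hC hrad hr p hp (hd e0)
      have h := heq (r • e0)
      convert this using 2
      linarith
    · apply (radial_integrable (fun r => Q (r • e0) ^ 2)).1
      simpa only [← hQφ] using hi2
    · apply (radial_integrable (fun r => Q (r • e0) ^ 4)).1
      simpa only [← hQφ] using hi4
    · apply (radial_integrable (fun r => p r ^ 2)).1
      refine hig.mono' ?_ ?_
      · exact ((hpc.comp continuous_norm).pow 2).aestronglyMeasurable
      · refine Eventually.of_forall fun x => ?_
        rw [Real.norm_of_nonneg (sq_nonneg _)]
        exact hpg x
  have h4 : (∫ x, Q x ^ 4) = 2 * π * RadData.tot (fun r => Q (r • e0)) := by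
    rw [RadData.tot, ← radial_integral (fun r => Q (r • e0) ^ 4)]
    simp only [← hQφ]
  have h2 : (∫ x, Q x ^ 2) = 2 * π * ∫ r in Set.Ioi (0:ℝ), r * Q (r • e0) ^ 2 := by
    rw [← radial_integral (fun r => Q (r • e0) ^ 2)]
    simp only [← hQφ]
  refine ⟨_, p, hR, h4, ?_⟩
  rw [h4, h2, hR.pohozaev]; ring
end

section

lemma ibp_prod1 {G D : ℝ × ℝ → ℝ} (hd : ∀ x y, HasDerivAt (fun x => G (x, y)) (D (x, y)) x)
    (hG : ∀ y, Integrable (fun x => G (x, y))) (hD : Integrable D) : ∫ z, D z = 0 := by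
  have hD' : Integrable D ((volume : Measure ℝ).prod volume) := hD
  have e : ∫ z, D z = ∫ y, ∫ x, D (x, y) := integral_prod_symm _ hD'
  rw [e]
  have h := hD'.prod_left_ae
  have : (fun y => ∫ x, D (x, y)) =ᵐ[volume] fun _ => 0 := by
    filter_upwards [h] with y hy
    exact integral_eq_zero_of_hasDerivAt_of_integrable (fun x => hd x y) hy (hG y)
  rw [integral_congr_ae this]; simp

lemma ibp_prod2 {G D : ℝ × ℝ → ℝ} (hd : ∀ x y, HasDerivAt (fun y => G (x, y)) (D (x, y)) y)
    (hG : ∀ x, Integrable (fun y => G (x, y))) (hD : Integrable D) : ∫ z, D z = 0 := by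
  have hD' : Integrable D ((volume : Measure ℝ).prod volume) := hD
  have e : ∫ z, D z = ∫ x, ∫ y, D (x, y) := integral_prod _ hD'
  rw [e]
  have h := hD'.prod_right_ae
  have : (fun x => ∫ y, D (x, y)) =ᵐ[volume] fun _ => 0 := by
    filter_upwards [h] with x hx
    exact integral_eq_zero_of_hasDerivAt_of_integrable (fun y => hd x y) hx (hG x)
  rw [integral_congr_ae this]; simp

lemma cum_bounds {f : ℝ → ℝ} (hf : Continuous f) (h0 : ∀ x, 0 ≤ f x) {R : ℝ}
    (hs : ∀ x, f x ≠ 0 → |x| < R) (x : ℝ) :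
    Integrable f ∧ 0 ≤ ∫ t in (-R)..x, f t ∧ (∫ t in (-R)..x, f t) ≤ (∫ t in (-R)..R, f t) ∧
      (∫ t in (-R)..R, f t) = ∫ t, f t := by
  have hi : Integrable f := by
    apply hf.integrable_of_hasCompactSupport
    apply HasCompactSupport.intro (isCompact_Icc (a := -R) (b := R))
    intro x hx
    by_contra h
    exact hx (abs_le.1 (hs x h).le)
  have key : ∀ x, (∫ t in (-R)..x, f t) = ∫ t in Set.Iic x, f t := by
    intro x
    rw [← intervalIntegral.integral_Iic_sub_Iic hi.integrableOn hi.integrableOn]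
    have : ∫ t in Set.Iic (-R), f t = 0 := by
      apply setIntegral_eq_zero_of_forall_eq_zero
      intro t ht
      by_contra h
      have := (abs_lt.1 (hs t h)).1
      exact absurd ht (not_le.2 this)
    rw [this, sub_zero]
  have tot : (∫ t in (-R)..R, f t) = ∫ t, f t := by
    rw [key]
    apply setIntegral_eq_integral_of_forall_compl_eq_zero
    intro t ht
    by_contra h
    exact ht (abs_lt.1 (hs t h)).2.le
  refine ⟨hi, ?_, ?_, tot⟩
  · rw [key]; exact setIntegral_nonneg measurableSet_Iic fun t _ => h0 t
  · rw [tot, key]; exact setIntegral_le_integral hi (Eventually.of_forall h0)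

lemma exists_theta : ∃ θ : ℝ → ℝ, ∀ s, 0 < s → s < 1 → 0 < cos (θ s) ∧
    HasDerivAt θ (π / (2 * cos (θ s) ^ 2)) s := by
  set h : ℝ → ℝ := fun t => (t + sin t * cos t) / π + 1 / 2 with hh
  have hder : ∀ t, HasDerivAt h ((2 * cos t ^ 2) / π) t := by
    intro t
    have := (((hasDerivAt_id t).add ((hasDerivAt_sin t).mul (hasDerivAt_cos t))).div_const π).add_const (1/2)
    refine this.congr_deriv ?_
    have := sin_sq_add_cos_sq t
    congr 1
    nlinarith
  have hpi := Real.pi_pos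
  have hmono : StrictMonoOn h (Set.Icc (-(π/2)) (π/2)) := by
    apply strictMonoOn_of_deriv_pos (convex_Icc _ _)
    · exact fun t _ => (hder t).continuousAt.continuousWithinAt
    · intro t ht
      rw [interior_Icc] at ht
      rw [(hder t).deriv]
      have := cos_pos_of_mem_Ioo ht
      positivity
  have hl : h (-(π/2)) = 0 := by simp [hh]; field_simp; ring
  have hr : h (π/2) = 1 := by simp [hh]; field_simp; ring
  have hex : ∀ s, ∃ t, 0 < s → s < 1 → t ∈ Set.Ioo (-(π/2)) (π/2) ∧ h t = s := by
    intro s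
    by_cases hs : 0 < s ∧ s < 1
    · have := intermediate_value_Ioo (by linarith : -(π/2) ≤ π/2)
        (fun t _ => (hder t).continuousAt.continuousWithinAt : ContinuousOn h _)
      rw [hl, hr] at this
      obtain ⟨t, ht, hts⟩ := this hs
      exact ⟨t, fun _ _ => ⟨ht, hts⟩⟩
    · exact ⟨0, fun a b => absurd ⟨a, b⟩ hs⟩
  choose θ hθ using hex
  refine ⟨θ, fun s h0 h1 => ?_⟩
  have hc := cos_pos_of_mem_Ioo (hθ s h0 h1).1
  refine ⟨hc, ?_⟩
  have hm : StrictMonoOn θ (Set.Ioo 0 1) := by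
    intro a ha b hb hab
    by_contra hcon
    push Not at hcon
    have ha' := hθ a ha.1 ha.2
    have hb' := hθ b hb.1 hb.2
    have := hmono.monotoneOn (Set.Ioo_subset_Icc_self hb'.1) (Set.Ioo_subset_Icc_self ha'.1) hcon
    rw [ha'.2, hb'.2] at this
    linarith
  have him : Set.Ioo (-(π/2)) (π/2) ⊆ θ '' Set.Ioo 0 1 := by
    intro t ht
    have hti := Set.Ioo_subset_Icc_self ht
    have h0t : 0 < h t := by
      rw [← hl]; exact hmono ⟨le_refl _, by linarith⟩ hti ht.1
    have h1t : h t < 1 := by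
      rw [← hr]; exact hmono hti ⟨by linarith, le_refl _⟩ ht.2
    refine ⟨h t, ⟨h0t, h1t⟩, ?_⟩
    have := hθ (h t) h0t h1t
    exact hmono.injOn (Set.Ioo_subset_Icc_self this.1) hti this.2
  have hcont : ContinuousAt θ s := by
    apply hm.continuousAt_of_image_mem_nhds (Ioo_mem_nhds h0 h1)
    exact mem_of_superset (Ioo_mem_nhds (hθ s h0 h1).1.1 (hθ s h0 h1).1.2) him
  have := HasDerivAt.of_local_left_inverse hcont (hder (θ s)) (by positivity) (by
    filter_upwards [Ioo_mem_nhds h0 h1] with y hy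
    exact (hθ y hy.1 hy.2).2)
  exact this.congr_deriv (inv_div _ _)
end

section

lemma knothe_eps {g g1 g2 N : ℝ × ℝ → ℝ} {R : ℝ} (hR : 0 < R) (hgc : Continuous g)
    (hg0 : ∀ z, 0 ≤ g z) (hs : ∀ x y, g (x, y) ≠ 0 → |x| < R ∧ |y| < R)
    (hx : ∀ x y, HasDerivAt (fun x => g (x, y)) (g1 (x, y)) x)
    (hy : ∀ x y, HasDerivAt (fun y => g (x, y)) (g2 (x, y)) y)
    (hi1 : Integrable g1) (hi2 : Integrable g2) (hN : Integrable N)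
    (hb : ∀ z s t, s ^ 2 + t ^ 2 ≤ 1 → -(s * g1 z + t * g2 z) ≤ N z)
    (hF : 0 < ∫ z, g z ^ 2) {ε : ℝ} (hε : 0 < ε) (hε' : ε < 1/2) :
    2 * √(π * (1 - 2 * ε) / ∫ z, g z ^ 2) * ((∫ z, g z ^ 2) - 2 * R * ε) ≤ ∫ z, N z := by
  set F := ∫ z, g z ^ 2 with hFdef
  obtain ⟨θ, hθ⟩ := exists_theta
  have hz1 : ∀ x y, R ≤ |x| → g (x, y) = 0 := by
    intro x y h
    by_contra h'
    exact absurd (hs x y h').1 (not_lt.2 h)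
  have hz2 : ∀ x y, R ≤ |y| → g (x, y) = 0 := by
    intro x y h
    by_contra h'
    exact absurd (hs x y h').2 (not_lt.2 h)
  -- compact support integrability
  have hcs : ∀ f : ℝ × ℝ → ℝ, Continuous f → Integrable (fun z => g z * f z) := by
    intro f hf
    apply (hgc.mul hf).integrable_of_hasCompactSupport
    apply HasCompactSupport.intro ((isCompact_Icc (a := -R) (b := R)).prod (isCompact_Icc (a := -R) (b := R)))
    rintro ⟨x, y⟩ hxy
    have : g (x, y) = 0 := by
      by_contra h
      exact hxy ⟨abs_le.1 (hs x y h).1.le, abs_le.1 (hs x y h).2.le⟩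
    simp [this]
  have hcs1 : ∀ y, ∀ f : ℝ → ℝ, Continuous f → Integrable (fun x => g (x, y) * f x) := by
    intro y f hf
    have : Continuous (fun x => g (x, y) * f x) := by fun_prop
    apply this.integrable_of_hasCompactSupport
    apply HasCompactSupport.intro (isCompact_Icc (a := -R) (b := R))
    intro x hxy
    have : g (x, y) = 0 := by
      by_contra h
      exact hxy (abs_le.1 (hs x y h).1.le)
    simp [this]
  have hcs2 : ∀ x, ∀ f : ℝ → ℝ, Continuous f → Integrable (fun y => g (x, y) * f y) := by
    intro x f hf
    have : Continuous (fun y => g (x, y) * f y) := by fun_prop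
    apply this.integrable_of_hasCompactSupport
    apply HasCompactSupport.intro (isCompact_Icc (a := -R) (b := R))
    intro y hxy
    have : g (x, y) = 0 := by
      by_contra h
      exact hxy (abs_le.1 (hs x y h).2.le)
    simp [this]
  -- partial masses
  set num : ℝ → ℝ → ℝ := fun x y => ∫ t in (-R)..y, g (x, t) ^ 2 with hnum
  have hnumc : Continuous (fun z : ℝ × ℝ => num z.1 z.2) := by
    apply intervalIntegral.continuous_parametric_intervalIntegral_of_continuous
      (f := fun (z : ℝ × ℝ) t => g (z.1, t) ^ 2) _ continuous_snd
    simp only [Function.uncurry_def]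
    fun_prop
  set a : ℝ → ℝ := fun x => num x R with ha
  have hac : Continuous a := by
    have : Continuous (fun x : ℝ => (x, R)) := by fun_prop
    exact hnumc.comp this
  have hslc : ∀ x, Continuous (fun y => g (x, y) ^ 2) := fun x => by fun_prop
  have hcb : ∀ x y, Integrable (fun y => g (x, y) ^ 2) ∧ 0 ≤ num x y ∧ num x y ≤ a x ∧
      a x = ∫ y, g (x, y) ^ 2 := by
    intro x y
    exact cum_bounds (hslc x) (fun _ => sq_nonneg _)
      (fun y h => (hs x y (fun h' => h (by simp [h']))).2) y
  have ha0 : ∀ x, 0 ≤ a x := fun x => (hcb x R).2.1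
  have has : ∀ x, a x ≠ 0 → |x| < R := by
    intro x h
    by_contra h'
    apply h
    rw [(hcb x R).2.2.2]
    simp [hz1 x _ (not_lt.1 h')]
  have hcbA := fun x => cum_bounds hac ha0 has x
  have hg2i : Integrable (fun z => g z ^ 2) := by
    have := hcs g hgc
    simpa only [sq] using this
  have hFa : F = ∫ x, a x := by
    have : F = ∫ x, ∫ y, g (x, y) ^ 2 :=
      integral_prod (μ := (volume : Measure ℝ)) (ν := (volume : Measure ℝ)) (fun z => g z ^ 2) hg2i
    rw [this]
    congr 1; funext x
    exact (hcb x R).2.2.2.symm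
  have hFR : (∫ t in (-R)..R, a t) = F := by rw [hFa]; exact (hcbA R).2.2.2
  set s : ℝ → ℝ := fun x => ε + (1 - 2 * ε) * (∫ t in (-R)..x, a t) / F with hsdef
  have hs0 : ∀ x, 0 < s x ∧ s x < 1 := by
    intro x
    have h1 := (hcbA x).2.1
    have h2 := (hcbA x).2.2.1
    rw [hFR] at h2
    have h3 : 0 ≤ (1 - 2 * ε) * (∫ t in (-R)..x, a t) / F := by
      apply div_nonneg (mul_nonneg (by linarith) h1) hF.le
    have h4 : (1 - 2 * ε) * (∫ t in (-R)..x, a t) / F ≤ 1 - 2 * ε := by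
      rw [div_le_iff₀ hF]
      apply mul_le_mul_of_nonneg_left h2 (by linarith)
    constructor <;> simp only [hsdef] <;> linarith
  have hsd : ∀ x, HasDerivAt s ((1 - 2 * ε) * a x / F) x := by
    intro x
    have := ((hac.integral_hasStrictDerivAt (-R) x).hasDerivAt.const_mul (1 - 2 * ε)).div_const F
    exact this.const_add ε
  set ℓ : ℝ → ℝ := fun x => cos (θ (s x)) with hℓ
  have hℓ0 : ∀ x, 0 < ℓ x := fun x => (hθ _ (hs0 x).1 (hs0 x).2).1
  have hθs : ∀ x, HasDerivAt (fun x => θ (s x)) (π / (2 * ℓ x ^ 2) * ((1 - 2 * ε) * a x / F)) x := by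
    intro x
    exact (hθ _ (hs0 x).1 (hs0 x).2).2.comp x (hsd x)
  have hθc : Continuous (fun x => θ (s x)) := continuous_iff_continuousAt.2 fun x => (hθs x).continuousAt
  have hℓc : Continuous ℓ := continuous_cos.comp hθc
  set T1 : ℝ → ℝ := fun x => sin (θ (s x)) with hT1
  have hT1c : Continuous T1 := continuous_sin.comp hθc
  set d1 : ℝ → ℝ := fun x => π / (2 * ℓ x) * ((1 - 2 * ε) * a x / F) with hd1
  have hT1d : ∀ x, HasDerivAt T1 (d1 x) x := by
    intro x
    refine (hθs x).sin.congr_deriv ?_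
    have := hℓ0 x
    simp only [hd1]
    change ℓ x * _ = _
    field_simp
  have hd1c : Continuous d1 := by
    apply Continuous.mul
    · exact continuous_const.div (by fun_prop) (fun x => by have := hℓ0 x; positivity)
    · fun_prop
  set T2 : ℝ × ℝ → ℝ := fun z => ℓ z.1 * (2 * num z.1 z.2 / (a z.1 + ε) - 1) with hT2
  have hae : ∀ x, 0 < a x + ε := fun x => by have := ha0 x; linarith
  have hT2c : Continuous T2 := by
    apply Continuous.mul (by fun_prop)
    apply Continuous.sub _ continuous_const
    exact Continuous.div (by fun_prop) (by fun_prop) (fun z => (hae z.1).ne')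
  set d2 : ℝ × ℝ → ℝ := fun z => ℓ z.1 * (2 * g z ^ 2 / (a z.1 + ε)) with hd2
  have hd2c : Continuous d2 := by
    apply Continuous.mul (by fun_prop)
    exact Continuous.div (by fun_prop) (by fun_prop) (fun z => (hae z.1).ne')
  have hT2d : ∀ x y, HasDerivAt (fun y => T2 (x, y)) (d2 (x, y)) y := by
    intro x y
    have := ((hslc x).integral_hasStrictDerivAt (-R) y).hasDerivAt
    exact ((((this.const_mul 2).div_const (a x + ε)).sub_const 1).const_mul (ℓ x))
  have hT2b : ∀ z, T1 z.1 ^ 2 + T2 z ^ 2 ≤ 1 := by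
    rintro ⟨x, y⟩
    obtain ⟨-, h1, h2, -⟩ := hcb x y
    have hc : (2 * num x y / (a x + ε) - 1) ^ 2 ≤ 1 := by
      rw [sq_le_one_iff_abs_le_one, abs_le]
      have h3 : 0 ≤ 2 * num x y / (a x + ε) := div_nonneg (by linarith) (hae x).le
      have h4 : 2 * num x y / (a x + ε) ≤ 2 := by
        rw [div_le_iff₀ (hae x)]; linarith
      constructor <;> linarith
    have h5 : T1 x ^ 2 + ℓ x ^ 2 = 1 := sin_sq_add_cos_sq _
    have h6 : T2 (x, y) ^ 2 ≤ ℓ x ^ 2 := by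
      simp only [hT2, mul_pow]
      exact mul_le_of_le_one_right (sq_nonneg _) hc
    simp only
    linarith
  have hT1b : ∀ z : ℝ × ℝ, ‖T1 z.1‖ ≤ 1 := fun z => by
    rw [Real.norm_eq_abs, ← sq_le_one_iff_abs_le_one]
    have := hT2b z
    nlinarith [sq_nonneg (T2 z)]
  have hT2b' : ∀ z : ℝ × ℝ, ‖T2 z‖ ≤ 1 := fun z => by
    rw [Real.norm_eq_abs, ← sq_le_one_iff_abs_le_one]
    have := hT2b z
    nlinarith [sq_nonneg (T1 z.1)]
  have j1 : Integrable (fun z : ℝ × ℝ => g1 z * T1 z.1) :=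
    hi1.mul_bdd (c := 1) (hT1c.comp continuous_fst).aestronglyMeasurable (Eventually.of_forall hT1b)
  have j2 : Integrable (fun z : ℝ × ℝ => g2 z * T2 z) :=
    hi2.mul_bdd (c := 1) hT2c.aestronglyMeasurable (Eventually.of_forall hT2b')
  have k1 : Integrable (fun z : ℝ × ℝ => g z * d1 z.1) := hcs _ (hd1c.comp continuous_fst)
  have k2 : Integrable (fun z : ℝ × ℝ => g z * d2 z) := hcs _ hd2c
  have z1 : ∫ z : ℝ × ℝ, (g1 z * T1 z.1 + g z * d1 z.1) = 0 := by
    apply ibp_prod1 (G := fun z => g z * T1 z.1)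
    · intro x y
      exact (hx x y).mul (hT1d x)
    · intro y
      exact hcs1 y T1 hT1c
    · exact j1.add k1
  have z2 : ∫ z : ℝ × ℝ, (g2 z * T2 z + g z * d2 z) = 0 := by
    apply ibp_prod2 (G := fun z => g z * T2 z)
    · intro x y
      exact (hy x y).mul (hT2d x y)
    · intro x
      exact hcs2 x (fun y => T2 (x, y)) (by fun_prop)
    · exact j2.add k2
  rw [integral_add j1 k1] at z1
  rw [integral_add j2 k2] at z2
  have hNge : (∫ z, g z * d1 z.1) + (∫ z, g z * d2 z) ≤ ∫ z, N z := by
    have e : (∫ z, g z * d1 z.1) + (∫ z, g z * d2 z) = ∫ z : ℝ × ℝ, -(T1 z.1 * g1 z + T2 z * g2 z) := by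
      have : ∀ z : ℝ × ℝ, -(T1 z.1 * g1 z + T2 z * g2 z) = -(g1 z * T1 z.1 + g2 z * T2 z) := by
        intro z; ring
      simp_rw [this]
      rw [integral_neg, integral_add j1 j2]
      linarith
    rw [e]
    refine integral_mono ?_ hN ?_
    · have := (j1.add j2).neg
      refine this.congr (Eventually.of_forall fun z => ?_)
      simp only [Pi.neg_apply, Pi.add_apply]; ring
    intro z
    exact hb z _ _ (hT2b z)
  set c := √(π * (1 - 2 * ε) / F) with hc
  have hc0 : 0 ≤ π * (1 - 2 * ε) / F := by
    apply div_nonneg (mul_nonneg pi_pos.le (by linarith)) hF.le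
  have hcsq : c ^ 2 = π * (1 - 2 * ε) / F := Real.sq_sqrt hc0
  have hcn : 0 ≤ c := Real.sqrt_nonneg _
  set b : ℝ → ℝ := fun x => a x / (a x + ε) with hbdef
  have hbc : Continuous b := hac.div (by fun_prop) (fun x => (hae x).ne')
  have hpt : ∀ z : ℝ × ℝ, 2 * c * (g z * (g z * b z.1)) ≤ g z * d1 z.1 + g z * d2 z := by
    rintro ⟨x, y⟩
    have hg := hg0 (x, y)
    have hb0 : 0 ≤ b x := div_nonneg (ha0 x) (hae x).le
    have hb1 : b x ≤ 1 := by rw [hbdef]; simp only; rw [div_le_one (hae x)]; linarith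
    suffices 2 * (c * (g (x,y) * b x)) ≤ d1 x + d2 (x, y) by
      have := mul_le_mul_of_nonneg_left this hg
      simp only
      nlinarith
    have hd1n : 0 ≤ d1 x := by
      have := hℓ0 x; have := ha0 x; have := pi_pos; have : 0 ≤ 1 - 2 * ε := by linarith
      simp only [hd1]; positivity
    have hd2n : 0 ≤ d2 (x, y) := by
      have := hℓ0 x; have := hae x
      simp only [hd2]; positivity
    have hprod : d1 x * d2 (x, y) = c ^ 2 * (g (x, y) ^ 2 * b x) := by
      rw [hcsq]; simp only [hd1, hd2, hbdef]
      have := hℓ0 x; have := hae x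
      field_simp
    have h1 : (c * (g (x,y) * b x)) ^ 2 ≤ d1 x * d2 (x, y) := by
      rw [hprod]
      have : (c * (g (x,y) * b x)) ^ 2 = c ^ 2 * (g (x, y) ^ 2 * b x) * b x := by ring
      rw [this]
      exact mul_le_of_le_one_right (by positivity) hb1
    have h2 : (2 * (c * (g (x,y) * b x))) ^ 2 ≤ (d1 x + d2 (x, y)) ^ 2 := by
      nlinarith [sq_nonneg (d1 x - d2 (x, y))]
    exact (sq_le_sq₀ (by positivity) (by positivity)).1 h2
  have kk : Integrable (fun z : ℝ × ℝ => g z * (g z * b z.1)) := hcs _ (by fun_prop)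
  have hint : 2 * c * ∫ z : ℝ × ℝ, g z * (g z * b z.1) ≤ (∫ z, g z * d1 z.1) + (∫ z, g z * d2 z) := by
    rw [← integral_const_mul, ← integral_add k1 k2]
    exact integral_mono (kk.const_mul _) (k1.add k2) hpt
  have hlow : F - 2 * R * ε ≤ ∫ z : ℝ × ℝ, g z * (g z * b z.1) := by
    have e1 : ∫ z : ℝ × ℝ, g z * (g z * b z.1) = ∫ x, a x * b x := by
      have : ∫ z : ℝ × ℝ, g z * (g z * b z.1) = ∫ x, ∫ y, g (x, y) * (g (x, y) * b x) :=
        integral_prod (μ := (volume : Measure ℝ)) (ν := (volume : Measure ℝ))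
          (fun z => g z * (g z * b z.1)) kk
      rw [this]
      congr 1; funext x
      rw [(hcb x R).2.2.2, ← integral_mul_const]
      congr 1; funext y; ring
    have e2 : ∫ x, a x * b x = ∫ x in (-R)..R, a x * b x := by
      have := (cum_bounds (f := fun x => a x * b x) (R := R) (hac.mul hbc)
        (fun x => mul_nonneg (ha0 x) (div_nonneg (ha0 x) (hae x).le))
        (fun x h => has x (left_ne_zero_of_mul h)) R).2.2.2
      exact this.symm
    rw [e1, e2]
    have e3 : F - 2 * R * ε = ∫ x in (-R)..R, (a x - ε) := by
      rw [intervalIntegral.integral_sub (hac.intervalIntegrable _ _) (by simp), hFR]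
      rw [intervalIntegral.integral_const, smul_eq_mul]; ring
    rw [e3]
    apply intervalIntegral.integral_mono_on (by linarith)
    · exact (by fun_prop : Continuous fun x => a x - ε).intervalIntegrable _ _
    · exact (hac.mul hbc).intervalIntegrable _ _
    · intro x _
      have h1 := hae x
      have h2 := ha0 x
      simp only [hbdef]
      rw [← mul_div_assoc, le_div_iff₀ h1]
      nlinarith
  have := mul_le_mul_of_nonneg_left hlow (by positivity : 0 ≤ 2 * c)
  linarith
end

section

lemma knothe_prod {g g1 g2 N : ℝ × ℝ → ℝ} {R : ℝ} (hR : 0 < R) (hgc : Continuous g)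
    (hg0 : ∀ z, 0 ≤ g z) (hs : ∀ x y, g (x, y) ≠ 0 → |x| < R ∧ |y| < R)
    (hx : ∀ x y, HasDerivAt (fun x => g (x, y)) (g1 (x, y)) x)
    (hy : ∀ x y, HasDerivAt (fun y => g (x, y)) (g2 (x, y)) y)
    (hi1 : Integrable g1) (hi2 : Integrable g2) (hN : Integrable N)
    (hb : ∀ z s t, s ^ 2 + t ^ 2 ≤ 1 → -(s * g1 z + t * g2 z) ≤ N z) :
    4 * π * (∫ z, g z ^ 2) ≤ (∫ z, N z) ^ 2 := by
  rcases (integral_nonneg (fun z => sq_nonneg (g z)) : 0 ≤ ∫ z, g z ^ 2).eq_or_lt with h | hF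
  · rw [← h]; simp; positivity
  have hNn : ∀ z, 0 ≤ N z := by
    intro z
    have := hb z 0 0 (by norm_num)
    simpa using this
  set F := ∫ z, g z ^ 2 with hFd
  have key : 2 * √(π * (1 - 2 * 0) / F) * (F - 2 * R * 0) ≤ ∫ z, N z := by
    have hcont : Continuous (fun ε : ℝ => 2 * √(π * (1 - 2 * ε) / F) * (F - 2 * R * ε)) := by fun_prop
    have ht : Tendsto (fun ε : ℝ => 2 * √(π * (1 - 2 * ε) / F) * (F - 2 * R * ε)) (nhdsWithin 0 (Set.Ioi 0))
        (nhds (2 * √(π * (1 - 2 * 0) / F) * (F - 2 * R * 0))) :=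
      (hcont.tendsto 0).mono_left nhdsWithin_le_nhds
    apply le_of_tendsto ht
    have : Set.Ioo (0:ℝ) (1/2) ∈ nhdsWithin (0:ℝ) (Set.Ioi 0) := Ioo_mem_nhdsGT (by norm_num)
    filter_upwards [this] with ε hε
    exact knothe_eps hR hgc hg0 hs hx hy hi1 hi2 hN hb hF hε.1 hε.2
  simp only [mul_zero, sub_zero, mul_one] at key
  have h2 := pow_le_pow_left₀ (by positivity) key 2
  rw [mul_pow, mul_pow, Real.sq_sqrt (by positivity)] at h2
  refine le_trans (le_of_eq ?_) h2
  field_simp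
  ring

/-- The identification of the plane with `ℝ × ℝ`. -/
def plane (z : ℝ × ℝ) : E2 := WithLp.toLp 2 ![z.1, z.2]

lemma plane_mp : MeasurePreserving plane := by
  have h1 := (volume_preserving_finTwoArrow ℝ).symm
  have h2 := (PiLp.volume_preserving_toLp (Fin 2))
  exact h2.comp h1

lemma plane_emb : MeasurableEmbedding plane := by
  have h1 := (MeasurableEquiv.finTwoArrow (α := ℝ)).symm.measurableEmbedding
  have h2 := (MeasurableEquiv.toLp 2 (Fin 2 → ℝ)).measurableEmbedding
  exact h2.comp h1

lemma plane_eq (z : ℝ × ℝ) : plane z = z.1 • EuclideanSpace.single 0 1 + z.2 • EuclideanSpace.single 1 1 := by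
  ext i; fin_cases i <;> simp [plane]

lemma plane_norm_sq (z : ℝ × ℝ) : ‖plane z‖ ^ 2 = z.1 ^ 2 + z.2 ^ 2 := by
  rw [EuclideanSpace.norm_sq_eq]; simp [plane, Fin.sum_univ_two]

lemma plane_continuous : Continuous plane := by
  have : plane = fun z : ℝ × ℝ => z.1 • (EuclideanSpace.single 0 1 : E2) + z.2 • (EuclideanSpace.single 1 1 : E2) :=
    funext plane_eq
  rw [this]; fun_prop

theorem sobolev_one {g : E2 → ℝ} (hd : Differentiable ℝ g) (h0 : ∀ x, 0 ≤ g x) {R : ℝ}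
    (hs : ∀ x, g x ≠ 0 → ‖x‖ < R) (hi : Integrable (fun x => ‖fderiv ℝ g x‖)) :
    4 * π * (∫ x, g x ^ 2) ≤ (∫ x, ‖fderiv ℝ g x‖) ^ 2 := by
  rw [← plane_mp.integral_comp plane_emb, ← plane_mp.integral_comp plane_emb]
  have hN : Integrable (fun z => ‖fderiv ℝ g (plane z)‖) :=
    (plane_mp.integrable_comp_emb plane_emb).2 hi
  have hgi : ∀ v : E2, ‖v‖ ≤ 1 → Integrable (fun z => fderiv ℝ g (plane z) v) := by
    intro v hv
    refine hN.mono' ?_ (Eventually.of_forall fun z => ?_)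
    · exact ((measurable_fderiv_apply_const ℝ g v).comp plane_continuous.measurable).aestronglyMeasurable
    · exact ((fderiv ℝ g (plane z)).le_opNorm v).trans (mul_le_of_le_one_right (norm_nonneg _) hv)
  refine knothe_prod (g := fun z => g (plane z)) (R := max R 1)
    (g1 := fun z => fderiv ℝ g (plane z) (EuclideanSpace.single 0 1))
    (g2 := fun z => fderiv ℝ g (plane z) (EuclideanSpace.single 1 1))
    (by positivity) (hd.continuous.comp plane_continuous) (fun z => h0 _) ?_ ?_ ?_ (hgi _ (by simp)) (hgi _ (by simp)) hN ?_
  · intro x y h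
    have h1 := hs _ h
    have h2 := plane_norm_sq (x, y)
    simp only at h2
    have hx : |x| ≤ ‖plane (x, y)‖ := abs_le_of_sq_le_sq (by nlinarith) (norm_nonneg _)
    have hy : |y| ≤ ‖plane (x, y)‖ := abs_le_of_sq_le_sq (by nlinarith) (norm_nonneg _)
    exact ⟨lt_max_of_lt_left (by linarith), lt_max_of_lt_left (by linarith)⟩
  · intro x y
    have hl : HasDerivAt (fun x => plane (x, y)) (EuclideanSpace.single 0 1) x := by
      simp_rw [plane_eq]
      simpa using ((hasDerivAt_id x).smul_const (EuclideanSpace.single 0 1 : E2)).add_const (y • EuclideanSpace.single 1 1)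
    exact (hd (plane (x, y))).hasFDerivAt.comp_hasDerivAt x hl
  · intro x y
    have hl : HasDerivAt (fun y => plane (x, y)) (EuclideanSpace.single 1 1) y := by
      simp_rw [plane_eq]
      simpa using ((hasDerivAt_id y).smul_const (EuclideanSpace.single 1 1 : E2)).const_add (x • EuclideanSpace.single 0 1)
    exact (hd (plane (x, y))).hasFDerivAt.comp_hasDerivAt y hl
  · intro z s t hst
    have h1 := (fderiv ℝ g (plane z)).le_opNorm (plane (s, t))
    have h2 : ‖plane (s, t)‖ ≤ 1 := by
      have := plane_norm_sq (s, t)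
      simp only at this
      rw [← sq_le_one_iff₀ (norm_nonneg _)]; linarith
    have h3 : fderiv ℝ g (plane z) (plane (s, t)) = s * fderiv ℝ g (plane z) (EuclideanSpace.single 0 1) + t * fderiv ℝ g (plane z) (EuclideanSpace.single 1 1) := by
      rw [plane_eq (s, t)]; simp
    rw [← h3]
    have h4 := mul_le_of_le_one_right (norm_nonneg (fderiv ℝ g (plane z))) h2
    have h5 := neg_abs_le (fderiv ℝ g (plane z) (plane (s, t)))
    rw [Real.norm_eq_abs] at h1
    linarith
end

section

/-- distribution function -/
def dist2 (u : E2 → ℝ) (t : ℝ) : ℝ := (volume : Measure E2).real {x | t < u x}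

lemma cs_set {S : Set E2} {f : E2 → ℝ} (hfin : volume S ≠ ⊤)
    (hi1 : IntegrableOn f S) (hi2 : IntegrableOn (fun x => f x ^ 2) S) :
    (∫ x in S, f x) ^ 2 ≤ (∫ x in S, f x ^ 2) * (volume : Measure E2).real S := by
  have h : ∀ c : ℝ, 0 ≤ (volume : Measure E2).real S * (c * c) + (-2 * ∫ x in S, f x) * c + ∫ x in S, f x ^ 2 := by
    intro c
    have h0 : 0 ≤ ∫ x in S, (f x - c) ^ 2 := integral_nonneg fun x => sq_nonneg _
    have e : ∫ x in S, (f x - c) ^ 2 = (∫ x in S, f x ^ 2) + (-2 * c) * (∫ x in S, f x) + (volume : Measure E2).real S * (c * c) := by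
      have hc : IntegrableOn (fun _ : E2 => c * c) S := integrableOn_const hfin
      have : ∀ x, (f x - c) ^ 2 = (f x ^ 2 + (-2 * c) * f x) + c * c := fun x => by ring
      simp_rw [this]
      have hadd : IntegrableOn (fun x => f x ^ 2 + (-2 * c) * f x) S := hi2.add (hi1.const_mul _)
      rw [integral_add hadd hc, integral_add hi2 (hi1.const_mul _), integral_const_mul]
      simp
    rw [e] at h0
    linarith
  have := discrim_le_zero h
  rw [discrim] at this
  nlinarith

lemma exists_ramp {a b ε : ℝ} (hε : 0 < ε) (hab : a + ε < b - ε) :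
    ∃ η : ℝ → ℝ, Continuous η ∧ (∀ s, 0 ≤ η s) ∧ (∀ s, η s ≤ 1) ∧ (∀ s, s ≤ a → η s = 0) ∧
      (∀ s, b ≤ s → η s = 0) ∧ b - a - 2 * ε ≤ ∫ s in a..b, η s := by
  set η : ℝ → ℝ := fun s => min 1 (max 0 (min (s - a) (b - s)) / ε) with hη
  have hc : Continuous η := by fun_prop
  have h0 : ∀ s, 0 ≤ η s := fun s => le_min zero_le_one (div_nonneg (le_max_left _ _) hε.le)
  refine ⟨η, hc, h0, fun s => min_le_left _ _, ?_, ?_, ?_⟩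
  · intro s hs
    have : max 0 (min (s - a) (b - s)) = 0 := max_eq_left ((min_le_left _ _).trans (by linarith))
    simp [hη, this]
  · intro s hs
    have : max 0 (min (s - a) (b - s)) = 0 := max_eq_left ((min_le_right _ _).trans (by linarith))
    simp [hη, this]
  · have h1 : ∫ s in (a+ε)..(b-ε), η s = b - a - 2 * ε := by
      have : ∫ s in (a+ε)..(b-ε), η s = ∫ s in (a+ε)..(b-ε), (1:ℝ) := by
        apply intervalIntegral.integral_congr
        intro s hs
        rw [Set.uIcc_of_le hab.le] at hs
        simp only [hη]
        apply min_eq_left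
        rw [le_div_iff₀ hε, one_mul]
        apply le_max_of_le_right
        exact le_min (by linarith [hs.1]) (by linarith [hs.2])
      rw [this]; simp; ring
    rw [← h1]
    apply intervalIntegral.integral_mono_interval (by linarith) hab.le (by linarith)
    · exact Eventually.of_forall h0
    · exact hc.intervalIntegrable _ _

variable {u : E2 → ℝ}

lemma cpt_fin {R : ℝ} (hs : ∀ x, u x ≠ 0 → ‖x‖ < R) {t : ℝ} (ht : 0 ≤ t) :
    volume {x | t < u x} < ⊤ := by
  refine (measure_mono (t := Metric.ball (0:E2) R) ?_).trans_lt Metric.isBounded_ball.measure_lt_top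
  intro x hx
  rw [mem_ball_zero_iff]
  exact hs x (lt_of_le_of_lt ht hx).ne'

lemma cpt_int {R : ℝ} {f : E2 → ℝ} (hf : Continuous f) (hs : ∀ x, f x ≠ 0 → ‖x‖ < R) : Integrable f := by
  apply hf.integrable_of_hasCompactSupport
  apply HasCompactSupport.intro (isCompact_closedBall (0:E2) R)
  intro x hx
  by_contra h
  exact hx (mem_closedBall_zero_iff.2 (hs x h).le)

lemma layer (hd : Differentiable ℝ u) {R : ℝ}
    (hs : ∀ x, u x ≠ 0 → ‖x‖ < R) (hg : Integrable (gradSq u)) {a b : ℝ} (ha : 0 < a) (hab : a < b) :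
    4 * π * dist2 u b * (b - a) ^ 2 ≤
      (∫ x in {x | a < u x ∧ u x ≤ b}, gradSq u x) * (dist2 u a - dist2 u b) := by
  set S : Set E2 := {x | a < u x ∧ u x ≤ b} with hS
  have hm : ∀ t, MeasurableSet {x | t < u x} := fun t =>
    (isOpen_lt continuous_const hd.continuous).measurableSet
  have hSm : MeasurableSet S := (hm a).inter (isClosed_le hd.continuous continuous_const).measurableSet
  have hSd : S = {x | a < u x} \ {x | b < u x} := by
    ext x; simp [hS]
  have hfa := cpt_fin hs ha.le
  have hfb := cpt_fin hs (ha.trans hab).le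
  have hSv : (volume : Measure E2).real S = dist2 u a - dist2 u b := by
    have hsub : {x | b < u x} ⊆ {x | a < u x} := fun x (hx : b < u x) => hab.trans hx
    rw [hSd, measureReal_sdiff hsub (hm b) hfa.ne]
    rfl
  have hSf : volume S ≠ ⊤ := ((measure_mono (fun x hx => hx.1)).trans_lt hfa).ne
  have hgm : Measurable (fun x => ‖fderiv ℝ u x‖) := (measurable_fderiv ℝ u).norm
  have hi2 : IntegrableOn (fun x => ‖fderiv ℝ u x‖ ^ 2) S := hg.integrableOn
  have hi1 : IntegrableOn (fun x => ‖fderiv ℝ u x‖) S := by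
    have h1 : IntegrableOn (fun _ : E2 => (1:ℝ)) S := integrableOn_const hSf
    refine (h1.add hi2).mono' hgm.aestronglyMeasurable (Eventually.of_forall fun x => ?_)
    rw [norm_norm]
    simp only [Pi.add_apply]
    nlinarith [sq_nonneg (‖fderiv ℝ u x‖ - 1)]
  have hcs := cs_set hSf hi1 hi2
  rw [hSv] at hcs
  refine le_trans ?_ hcs
  have key : ∀ ε, 0 < ε → a + ε < b - ε →
      4 * π * (dist2 u b * (b - a - 2 * ε) ^ 2) ≤ (∫ x in S, ‖fderiv ℝ u x‖) ^ 2 := by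
    intro ε hε hε'
    obtain ⟨η, hηc, hη0, hη1, hηa, hηb, hηi⟩ := exists_ramp hε hε'
    set Φ : ℝ → ℝ := fun s => ∫ t in a..s, η t with hΦ
    have hΦd : ∀ s, HasDerivAt Φ (η s) s := fun s => (hηc.integral_hasStrictDerivAt a s).hasDerivAt
    have hΦa : ∀ s, s ≤ a → Φ s = 0 := by
      intro s hsa
      simp only [hΦ]
      rw [intervalIntegral.integral_symm]
      rw [intervalIntegral.integral_congr (g := fun _ => 0)]
      · simp
      · intro t ht
        rw [Set.uIcc_of_le hsa] at ht
        exact hηa t ht.2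
    have hΦb : ∀ s, b ≤ s → Φ s = Φ b := by
      intro s hsb
      simp only [hΦ]
      rw [← intervalIntegral.integral_add_adjacent_intervals (hηc.intervalIntegrable a b) (hηc.intervalIntegrable b s)]
      rw [intervalIntegral.integral_congr (a := b) (b := s) (g := fun _ => 0)]
      · simp
      · intro t ht
        rw [Set.uIcc_of_le hsb] at ht
        exact hηb t ht.1
    have hΦ0 : ∀ s, 0 ≤ Φ s := by
      intro s
      rcases le_total s a with h | h
      · rw [hΦa s h]
      · exact intervalIntegral.integral_nonneg h fun t _ => hη0 t
    have hΦc : Continuous Φ := continuous_iff_continuousAt.2 fun s => (hΦd s).continuousAt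
    set g : E2 → ℝ := fun x => Φ (u x) with hgdef
    have hgd : ∀ x, HasFDerivAt g (η (u x) • fderiv ℝ u x) x := fun x =>
      (hΦd (u x)).comp_hasFDerivAt x (hd x).hasFDerivAt
    have hgf : ∀ x, ‖fderiv ℝ g x‖ = η (u x) * ‖fderiv ℝ u x‖ := by
      intro x
      rw [(hgd x).fderiv, norm_smul, Real.norm_of_nonneg (hη0 _)]
    have hle : ∀ x, ‖fderiv ℝ g x‖ ≤ S.indicator (fun x => ‖fderiv ℝ u x‖) x := by
      intro x
      rw [hgf]
      by_cases hx : x ∈ S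
      · rw [Set.indicator_of_mem hx]
        exact mul_le_of_le_one_left (norm_nonneg _) (hη1 _)
      · rw [Set.indicator_of_notMem hx]
        have : η (u x) = 0 := by
          rcases le_or_gt (u x) a with h | h
          · exact hηa _ h
          · apply hηb
            by_contra h'
            exact hx ⟨h, by linarith⟩
        rw [this, zero_mul]
    have hind : Integrable (S.indicator (fun x => ‖fderiv ℝ u x‖)) := hi1.integrable_indicator hSm
    have hgi : Integrable (fun x => ‖fderiv ℝ g x‖) := by
      refine hind.mono' (measurable_fderiv ℝ g).norm.aestronglyMeasurable (Eventually.of_forall fun x => ?_)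
      rw [norm_norm]; exact hle x
    have hgs : ∀ x, g x ≠ 0 → ‖x‖ < R := by
      intro x hx
      apply hs
      intro h
      exact hx (hΦa _ (by rw [h]; exact ha.le))
    have hsob := sobolev_one (fun x => (hgd x).differentiableAt) (fun x => hΦ0 _) hgs hgi
    have h1 : ∫ x, ‖fderiv ℝ g x‖ ≤ ∫ x in S, ‖fderiv ℝ u x‖ := by
      rw [← integral_indicator hSm]
      exact integral_mono hgi hind hle
    have h2 : dist2 u b * (b - a - 2 * ε) ^ 2 ≤ ∫ x, g x ^ 2 := by
      have e : dist2 u b * (b - a - 2 * ε) ^ 2 = ∫ x in {x | b < u x}, (b - a - 2 * ε) ^ 2 := by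
        simp [dist2]
      rw [e, ← integral_indicator (hm b)]
      apply integral_mono
      · exact (integrableOn_const hfb.ne).integrable_indicator (hm b)
      · apply cpt_int (R := R) ((hΦc.comp hd.continuous).pow 2)
        intro x hx
        apply hgs
        intro h
        apply hx
        change g x ^ 2 = 0
        rw [h]; simp
      · intro x
        by_cases hx : b < u x
        · rw [Set.indicator_of_mem (by exact hx)]
          simp only [hgdef]
          rw [hΦb _ hx.le]
          exact pow_le_pow_left₀ (by linarith) hηi 2
        · rw [Set.indicator_of_notMem (by exact hx)]
          exact sq_nonneg _
    calc 4 * π * (dist2 u b * (b - a - 2 * ε) ^ 2) ≤ 4 * π * ∫ x, g x ^ 2 := by gcongr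
      _ ≤ _ := hsob
      _ ≤ _ := by
        gcongr
  have hcont : Continuous (fun ε : ℝ => 4 * π * (dist2 u b * (b - a - 2 * ε) ^ 2)) := by fun_prop
  have ht := (hcont.tendsto 0).mono_left (nhdsWithin_le_nhds (s := Set.Ioi (0:ℝ)))
  have hfin := le_of_tendsto ht (b := (∫ x in S, ‖fderiv ℝ u x‖) ^ 2) (by
    have : Set.Ioo (0:ℝ) ((b-a)/2) ∈ nhdsWithin (0:ℝ) (Set.Ioi 0) := Ioo_mem_nhdsGT (by linarith)
    filter_upwards [this] with ε hε
    exact key ε hε.1 (by linarith [hε.2]))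
  simp only [mul_zero, sub_zero] at hfin
  linarith
end

section

lemma nested_pow {c : ℕ → ℝ} (h : ∀ j, c j = 0 ∨ c j = 1) (ha : ∀ j, c (j+1) = 1 → c j = 1)
    {p : ℕ} (hp : p ≠ 0) (N : ℕ) :
    (∑ j ∈ Finset.range N, c j) ^ p = ∑ j ∈ Finset.range N, (((j:ℝ)+1) ^ p - (j:ℝ) ^ p) * c j := by
  have hall : ∀ j, c j = 1 → ∑ i ∈ Finset.range j, c i = j := by
    intro j
    induction j with
    | zero => intro; simp
    | succ j ih =>
      intro hj
      have := ha j hj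
      rw [Finset.sum_range_succ, ih this, this]; push_cast; ring
  induction N with
  | zero => simp [hp]
  | succ N ih =>
    rw [Finset.sum_range_succ _ N, Finset.sum_range_succ _ N, ← ih]
    rcases h N with h0 | h1
    · simp [h0]
    · rw [hall N h1, h1]; ring

lemma nested_integral {S : ℕ → Set E2} (hm : ∀ j, MeasurableSet (S j)) (hf : ∀ j, volume (S j) < ⊤)
    (ha : ∀ j, S (j+1) ⊆ S j) {p : ℕ} (hp : p ≠ 0) (N : ℕ) :
    Integrable (fun x => (∑ j ∈ Finset.range N, (S j).indicator (fun _ => (1:ℝ)) x) ^ p) ∧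
    ∫ x, (∑ j ∈ Finset.range N, (S j).indicator (fun _ => (1:ℝ)) x) ^ p =
      ∑ j ∈ Finset.range N, (((j:ℝ)+1) ^ p - (j:ℝ) ^ p) * (volume : Measure E2).real (S j) := by
  have e : ∀ x, (∑ j ∈ Finset.range N, (S j).indicator (fun _ => (1:ℝ)) x) ^ p =
      ∑ j ∈ Finset.range N, (((j:ℝ)+1) ^ p - (j:ℝ) ^ p) * (S j).indicator (fun _ => (1:ℝ)) x := by
    intro x
    apply nested_pow _ _ hp
    · intro j
      by_cases hx : x ∈ S j <;> simp [hx]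
    · intro j hj
      have : x ∈ S (j+1) := by
        by_contra h; simp [h] at hj
      simp [ha j this]
  have hi : ∀ j, Integrable ((S j).indicator (fun _ => (1:ℝ))) := fun j =>
    (integrableOn_const (hf j).ne).integrable_indicator (hm j)
  simp_rw [e]
  refine ⟨integrable_finsetSum _ fun j _ => (hi j).const_mul _, ?_⟩
  rw [integral_finsetSum _ fun j _ => (hi j).const_mul _]
  apply Finset.sum_congr rfl
  intro j _
  rw [integral_const_mul, integral_indicator (hm j)]
  simp

/-- superlevel counting function -/
def cnt (u : E2 → ℝ) (δ : ℝ) (k N : ℕ) (x : E2) : ℝ :=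
  ∑ j ∈ Finset.range N, {x | ((j:ℝ) + k) * δ < u x}.indicator (fun _ => (1:ℝ)) x

lemma cnt_nonneg (u : E2 → ℝ) (δ : ℝ) (k N : ℕ) (x : E2) : 0 ≤ cnt u δ k N x :=
  Finset.sum_nonneg fun j _ => Set.indicator_nonneg (fun _ _ => zero_le_one) _

lemma cnt_le {u : E2 → ℝ} {δ : ℝ} (hδ : 0 < δ) {k : ℕ} (hk : 1 ≤ k) (N : ℕ) {x : E2} (hu : 0 ≤ u x) :
    δ * cnt u δ k N x ≤ u x := by
  have hk' : (1:ℝ) ≤ k := by exact_mod_cast hk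
  have hN : ∀ N, cnt u δ k N x ≤ N := by
    intro N
    calc cnt u δ k N x ≤ ∑ j ∈ Finset.range N, (1:ℝ) :=
          Finset.sum_le_sum fun j _ => Set.indicator_le_self' (fun _ _ => zero_le_one) _
      _ = N := by simp
  induction N with
  | zero => simp [cnt, hu]
  | succ N ih =>
    by_cases h : ((N:ℝ) + k) * δ < u x
    · have := hN (N+1)
      push_cast at this
      nlinarith
    · have : cnt u δ k (N+1) x = cnt u δ k N x := by
        simp [cnt, Finset.sum_range_succ, h]
      rw [this]; exact ih

lemma le_cnt {u : E2 → ℝ} {δ : ℝ} (hδ : 0 < δ) (k N : ℕ) {x : E2} :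
    min (N * δ) (u x - k * δ) ≤ δ * cnt u δ k N x := by
  induction N with
  | zero => simp [cnt]
  | succ N ih =>
    by_cases h : ((N:ℝ) + k) * δ < u x
    · have : cnt u δ k (N+1) x = cnt u δ k N x + 1 := by
        simp [cnt, Finset.sum_range_succ, h]
      rw [this]
      rw [min_eq_left (by linarith)] at ih
      refine (min_le_left _ _).trans ?_
      push_cast
      linarith
    · have : cnt u δ k (N+1) x = cnt u δ k N x := by
        simp [cnt, Finset.sum_range_succ, h]
      rw [this]
      push Not at h
      rw [min_eq_right (by linarith)] at ih
      exact (min_le_right _ _).trans ih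

lemma cnt_integral {u : E2 → ℝ} (hc : Continuous u) {R : ℝ} (hs : ∀ x, u x ≠ 0 → ‖x‖ < R)
    {δ : ℝ} (hδ : 0 < δ) (k N : ℕ) {p : ℕ} (hp : p ≠ 0) :
    Integrable (fun x => cnt u δ k N x ^ p) ∧ ∫ x, cnt u δ k N x ^ p =
      ∑ j ∈ Finset.range N, (((j:ℝ)+1) ^ p - (j:ℝ) ^ p) * dist2 u (((j:ℝ) + k) * δ) := by
  apply nested_integral (S := fun j : ℕ => {x | ((j:ℝ) + k) * δ < u x}) _ _ _ hp N
  · intro j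
    exact (isOpen_lt continuous_const hc).measurableSet
  · intro j
    exact cpt_fin hs (by positivity)
  · intro j x hx
    simp only [Set.mem_setOf_eq] at hx ⊢
    push_cast at hx
    nlinarith

lemma ball_vol {ρ : ℝ} (h : 0 ≤ ρ) : (volume : Measure E2).real {x | ‖x‖ < ρ} = π * ρ ^ 2 := by
  have : {x : E2 | ‖x‖ < ρ} = Metric.ball 0 ρ := by ext x; simp
  rw [this, Measure.real, EuclideanSpace.volume_ball_fin_two]
  simp [h, Real.pi_pos.le]; ring

lemma ballcnt_integral {ρ : ℕ → ℝ} (h0 : ∀ j, 0 ≤ ρ j) (ha : ∀ j, ρ (j+1) ≤ ρ j) (N : ℕ) {p : ℕ} (hp : p ≠ 0) :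
    Integrable (fun x : E2 => (∑ j ∈ Finset.range N, {x : E2 | ‖x‖ < ρ j}.indicator (fun _ => (1:ℝ)) x) ^ p) ∧
    ∫ x : E2, (∑ j ∈ Finset.range N, {x : E2 | ‖x‖ < ρ j}.indicator (fun _ => (1:ℝ)) x) ^ p =
      ∑ j ∈ Finset.range N, (((j:ℝ)+1) ^ p - (j:ℝ) ^ p) * (π * ρ j ^ 2) := by
  have := nested_integral (S := fun j : ℕ => {x : E2 | ‖x‖ < ρ j}) (fun j =>
    (isOpen_lt continuous_norm continuous_const).measurableSet) (fun j => by
      refine (measure_mono (t := Metric.ball (0:E2) (ρ j)) ?_).trans_lt Metric.isBounded_ball.measure_lt_top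
      intro x hx; simpa using hx) (fun j x hx => lt_of_lt_of_le hx (ha j)) hp N
  simp_rw [ball_vol (h0 _)] at this
  exact this
end

section

/-- piecewise linear ramp from 1 (at `b`) to 0 (at `a`) -/
def ramp (a b s : ℝ) : ℝ := max 0 (min 1 ((a - s) / (a - b)))

/-- right derivative of the ramp -/
def rampD (a b s : ℝ) : ℝ := (Set.Ico b a).indicator (fun _ => -1 / (a - b)) s

lemma ramp_cont (a b : ℝ) : Continuous (ramp a b) := by unfold ramp; fun_prop
lemma ramp_nonneg (a b s : ℝ) : 0 ≤ ramp a b s := le_max_left _ _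
lemma ramp_le_one (a b s : ℝ) : ramp a b s ≤ 1 := max_le zero_le_one (min_le_left _ _)

lemma ramp_zero {a b s : ℝ} (hab : b ≤ a) (h : a ≤ s) : ramp a b s = 0 := by
  apply max_eq_left
  exact (min_le_right _ _).trans (div_nonpos_of_nonpos_of_nonneg (by linarith) (by linarith))

lemma ramp_one {a b s : ℝ} (hab : b < a) (h : s ≤ b) : ramp a b s = 1 := by
  unfold ramp
  rw [min_eq_left, max_eq_right zero_le_one]
  rw [le_div_iff₀ (by linarith)]; linarith

lemma ramp_mid {a b s : ℝ} (hab : b < a) (h : b ≤ s) (h' : s ≤ a) : ramp a b s = (a - s) / (a - b) := by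
  unfold ramp
  rw [min_eq_right, max_eq_right]
  · exact div_nonneg (by linarith) (by linarith)
  · rw [div_le_one (by linarith)]; linarith

lemma ramp_deriv {a b s : ℝ} (hab : b ≤ a) (hdeg : a = b → b = 0) (hs : 0 < s) :
    HasDerivWithinAt (ramp a b) (rampD a b s) (Set.Ioi s) s := by
  rcases le_or_gt a s with h | h
  · have : rampD a b s = 0 := Set.indicator_of_notMem (fun hh => absurd hh.2 (not_lt.2 h)) _
    rw [this]
    refine (hasDerivWithinAt_const s (Set.Ioi s) (0:ℝ)).congr ?_ (ramp_zero hab h)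
    intro x hx
    exact ramp_zero hab (h.trans (le_of_lt hx))
  have hlt : b < a := by
    refine lt_of_le_of_ne hab fun e => ?_
    have := hdeg e.symm
    linarith
  rcases lt_or_ge s b with h2 | h2
  · have : rampD a b s = 0 := Set.indicator_of_notMem (fun hh => absurd hh.1 (not_le.2 h2)) _
    rw [this]
    apply HasDerivAt.hasDerivWithinAt
    refine (hasDerivAt_const s (1:ℝ)).congr_of_eventuallyEq ?_
    filter_upwards [Iio_mem_nhds h2] with x hx
    exact ramp_one hlt (le_of_lt hx)
  · have : rampD a b s = -1 / (a - b) := by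
      have hmem : s ∈ Set.Ico b a := ⟨h2, h⟩
      simp [rampD, hmem]
    rw [this]
    have hd : HasDerivWithinAt (fun x => (a - x) / (a - b)) (-1 / (a - b)) (Set.Ioi s) s :=
      (((hasDerivAt_id s).const_sub a).div_const (a - b)).hasDerivWithinAt
    refine hd.congr_of_eventuallyEq ?_ (ramp_mid hlt h2 h.le)
    filter_upwards [Ioo_mem_nhdsGT h] with x hx
    exact ramp_mid hlt (h2.trans hx.1.le) hx.2.le

lemma rampD_int {a b R : ℝ} (hab : b ≤ a) (hb : 0 ≤ b) (hR : 0 ≤ R) :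
    IntervalIntegrable (fun r => r * rampD a b r ^ 2) volume 0 R ∧
    ∫ r in (0:ℝ)..R, r * rampD a b r ^ 2 ≤ (a + b) / (2 * (a - b)) := by
  have e : (fun r => r * rampD a b r ^ 2) = (Set.Ico b a).indicator (fun r => r * (-1 / (a - b)) ^ 2) := by
    funext r
    by_cases h : r ∈ Set.Ico b a <;> simp [rampD, h]
  have hc : Continuous (fun r : ℝ => r * (-1 / (a - b)) ^ 2) := by fun_prop
  have hi : Integrable ((Set.Ico b a).indicator (fun r => r * (-1 / (a - b)) ^ 2)) :=
    ((hc.continuousOn.integrableOn_Icc (a := b) (b := a)).mono_set Set.Ico_subset_Icc_self).integrable_indicator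
      measurableSet_Ico
  rw [e]
  refine ⟨hi.intervalIntegrable, ?_⟩
  rw [intervalIntegral.integral_of_le hR]
  refine (setIntegral_le_integral hi ?_).trans ?_
  · refine Eventually.of_forall fun r => Set.indicator_nonneg (fun r hr => ?_) _
    exact mul_nonneg (hb.trans hr.1) (sq_nonneg _)
  · rw [integral_indicator measurableSet_Ico, integral_Ico_eq_integral_Ioo, ← integral_Ioc_eq_integral_Ioo,
      ← intervalIntegral.integral_of_le hab, intervalIntegral.integral_mul_const, integral_id]
    rcases eq_or_lt_of_le hab with h | h
    · simp [h]
    · apply le_of_eq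
      have : a - b ≠ 0 := by linarith
      field_simp
      ring

lemma rampD_disj {ρ : ℕ → ℝ} (ha : Antitone ρ) {i j : ℕ} (hij : i ≠ j) (s : ℝ) :
    rampD (ρ i) (ρ (i+1)) s * rampD (ρ j) (ρ (j+1)) s = 0 := by
  wlog h : i < j generalizing i j
  · rw [mul_comm]; exact this hij.symm (by omega)
  by_cases h1 : s ∈ Set.Ico (ρ (i+1)) (ρ i)
  · have h2 : s ∉ Set.Ico (ρ (j+1)) (ρ j) := by
      intro h2
      have := ha (by omega : i + 1 ≤ j)
      linarith [h1.1, h2.2]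
    simp [rampD, h2]
  · simp [rampD, h1]

lemma rampD_sq {ρ : ℕ → ℝ} (ha : Antitone ρ) (δ : ℝ) (N : ℕ) (s : ℝ) :
    (∑ j ∈ Finset.range N, δ * rampD (ρ j) (ρ (j+1)) s) ^ 2 =
      ∑ j ∈ Finset.range N, δ ^ 2 * rampD (ρ j) (ρ (j+1)) s ^ 2 := by
  rw [sq, Finset.sum_mul_sum]
  apply Finset.sum_congr rfl
  intro i hi
  rw [Finset.sum_eq_single i]
  · ring
  · intro j _ hj
    have := rampD_disj ha (Ne.symm hj) s
    calc _ = δ ^ 2 * (rampD (ρ i) (ρ (i+1)) s * rampD (ρ j) (ρ (j+1)) s) := by ring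
      _ = 0 := by rw [this, mul_zero]
  · intro h; exact absurd hi h

/-- the one dimensional inequality applied to a piecewise linear profile -/
lemma profile {φ p : ℝ → ℝ} (h : RadData φ p) {ρ : ℕ → ℝ} (ha : Antitone ρ) (h0 : ∀ j, 0 ≤ ρ j)
    (hdeg : ∀ j, ρ j = ρ (j+1) → ρ (j+1) = 0) (hpos : 0 < ρ 0) {δ : ℝ} (hδ : 0 < δ) {N : ℕ} (hN : 0 < N) :
    √(2 * π * RadData.tot φ * (δ ^ 4 * ∑ j ∈ Finset.range N, (((j:ℝ)+1) ^ 4 - (j:ℝ) ^ 4) * (π * ρ (j+1) ^ 2))) ≤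
      (∑ j ∈ Finset.range N, π * δ ^ 2 * ((ρ j + ρ (j+1)) / (ρ j - ρ (j+1)))) +
      δ ^ 2 * ∑ j ∈ Finset.range N, (((j:ℝ)+1) ^ 2 - (j:ℝ) ^ 2) * (π * ρ j ^ 2) := by
  have hab : ∀ j, ρ (j+1) ≤ ρ j := fun j => ha (Nat.le_succ j)
  set f : ℝ → ℝ := fun s => ∑ j ∈ Finset.range N, δ * ramp (ρ j) (ρ (j+1)) s with hf
  set f' : ℝ → ℝ := fun s => ∑ j ∈ Finset.range N, δ * rampD (ρ j) (ρ (j+1)) s with hf'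
  have hfc : Continuous f := by
    apply continuous_finsetSum
    intro j _
    exact continuous_const.mul (ramp_cont _ _)
  have hfn : ∀ s, 0 ≤ f s := fun s =>
    Finset.sum_nonneg fun j _ => mul_nonneg hδ.le (ramp_nonneg _ _ _)
  have hfz : ∀ s, ρ 0 ≤ s → f s = 0 := by
    intro s hs
    apply Finset.sum_eq_zero
    intro j _
    rw [ramp_zero (hab j) ((ha (Nat.zero_le j)).trans hs), mul_zero]
  have hfp : ∀ s, 0 ≤ s → s < ρ 0 → 0 < f s := by
    intro s hs hs'
    have h1 : δ * ramp (ρ 0) (ρ (0+1)) s ≤ f s :=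
      Finset.single_le_sum (f := fun j => δ * ramp (ρ j) (ρ (j+1)) s)
        (fun j _ => mul_nonneg hδ.le (ramp_nonneg _ _ _)) (Finset.mem_range.2 hN)
    refine lt_of_lt_of_le (mul_pos hδ ?_) h1
    have hlt : ρ (0+1) < ρ 0 := by
      refine lt_of_le_of_ne (hab 0) fun e => ?_
      have := hdeg 0 e.symm
      linarith
    rcases le_total s (ρ (0+1)) with h2 | h2
    · rw [ramp_one hlt h2]; exact one_pos
    · rw [ramp_mid hlt h2 hs'.le]
      exact div_pos (by linarith) (by linarith)
  have hsq : (fun r => r * f' r ^ 2) = fun r => ∑ j ∈ Finset.range N, δ ^ 2 * (r * rampD (ρ j) (ρ (j+1)) r ^ 2) := by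
    funext r
    simp only [hf']
    rw [rampD_sq ha, Finset.mul_sum]
    apply Finset.sum_congr rfl
    intro j _; ring
  have hii : ∀ j ∈ Finset.range N, IntervalIntegrable (fun r => δ ^ 2 * (r * rampD (ρ j) (ρ (j+1)) r ^ 2)) volume 0 (ρ 0) :=
    fun j _ => (rampD_int (hab j) (h0 _) hpos.le).1.const_mul _
  have hi : IntervalIntegrable (fun r => r * f' r ^ 2) volume 0 (ρ 0) := by
    rw [hsq]
    have := IntervalIntegrable.sum (Finset.range N) hii
    have e : (∑ j ∈ Finset.range N, fun r => δ ^ 2 * (r * rampD (ρ j) (ρ (j+1)) r ^ 2)) =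
        fun r => ∑ j ∈ Finset.range N, δ ^ 2 * (r * rampD (ρ j) (ρ (j+1)) r ^ 2) := by
      funext r
      simp
    rw [e] at this
    exact this
  have main := h.oneD hpos hfc hfp (hfz _ le_rfl) (f' := f') (fun r hr _ => by
    have := HasDerivWithinAt.fun_sum (u := Finset.range N) (fun j _ => (ramp_deriv (hab j) (hdeg j) hr).const_mul δ)
    exact this) hi
  have hE : ∫ r in (0:ℝ)..(ρ 0), r * f' r ^ 2 ≤ ∑ j ∈ Finset.range N, δ ^ 2 * ((ρ j + ρ (j+1)) / (2 * (ρ j - ρ (j+1)))) := by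
    rw [hsq, intervalIntegral.integral_finsetSum hii]
    apply Finset.sum_le_sum
    intro j _
    rw [intervalIntegral.integral_const_mul]
    exact mul_le_mul_of_nonneg_left (rampD_int (hab j) (h0 _) hpos.le).2 (sq_nonneg _)
  have hrad : ∀ q : ℕ, q ≠ 0 → ∫ x : E2, f ‖x‖ ^ q = 2 * π * ∫ r in (0:ℝ)..(ρ 0), r * f r ^ q := by
    intro q hq
    rw [radial_integral (fun r => f r ^ q), intervalIntegral.integral_of_le hpos.le]
    congr 1
    apply setIntegral_eq_of_subset_of_forall_sdiff_eq_zero measurableSet_Ioi Set.Ioc_subset_Ioi_self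
    intro r hr
    have : ρ 0 ≤ r := by
      by_contra hh
      exact hr.2 ⟨hr.1, by linarith⟩
    rw [hfz r this]; simp [hq]
  have hfi : ∀ q : ℕ, q ≠ 0 → Integrable (fun x : E2 => f ‖x‖ ^ q) := by
    intro q hq
    apply cpt_int (R := ρ 0) (by fun_prop)
    intro x hx
    by_contra hh
    apply hx
    rw [hfz _ (by linarith)]; simp [hq]
  have h2 : ∫ x : E2, f ‖x‖ ^ 2 ≤ δ ^ 2 * ∑ j ∈ Finset.range N, (((j:ℝ)+1) ^ 2 - (j:ℝ) ^ 2) * (π * ρ j ^ 2) := by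
    have hb := ballcnt_integral h0 hab N (p := 2) (by norm_num)
    rw [← hb.2, ← integral_const_mul]
    apply integral_mono (hfi 2 (by norm_num)) (hb.1.const_mul _)
    intro x
    simp only
    rw [← mul_pow]
    apply pow_le_pow_left₀ (hfn _)
    simp only [hf]
    rw [Finset.mul_sum]
    apply Finset.sum_le_sum
    intro j _
    apply mul_le_mul_of_nonneg_left _ hδ.le
    by_cases hx : ‖x‖ < ρ j
    · rw [Set.indicator_of_mem (by exact hx)]; exact ramp_le_one _ _ _
    · rw [Set.indicator_of_notMem (by exact hx), ramp_zero (hab j) (by linarith)]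
  have h4 : δ ^ 4 * ∑ j ∈ Finset.range N, (((j:ℝ)+1) ^ 4 - (j:ℝ) ^ 4) * (π * ρ (j+1) ^ 2) ≤ ∫ x : E2, f ‖x‖ ^ 4 := by
    have hb := ballcnt_integral (fun j => h0 (j+1)) (fun j => hab (j+1)) N (p := 4) (by norm_num)
    rw [← hb.2, ← integral_const_mul]
    apply integral_mono (hb.1.const_mul _) (hfi 4 (by norm_num))
    intro x
    simp only
    rw [← mul_pow]
    apply pow_le_pow_left₀
    · apply mul_nonneg hδ.le
      exact Finset.sum_nonneg fun j _ => Set.indicator_nonneg (fun _ _ => zero_le_one) _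
    simp only [hf]
    rw [Finset.mul_sum]
    apply Finset.sum_le_sum
    intro j _
    apply mul_le_mul_of_nonneg_left _ hδ.le
    by_cases hx : ‖x‖ < ρ (j+1)
    · have hlt : ρ (j+1) < ρ j := by
        refine lt_of_le_of_ne (hab j) fun e => ?_
        have := hdeg j e.symm
        linarith [norm_nonneg x]
      rw [Set.indicator_of_mem (by exact hx), ramp_one hlt hx.le]
    · rw [Set.indicator_of_notMem (by exact hx)]; exact ramp_nonneg _ _ _
  have htot := h.tot_pos
  have hpi := pi_pos
  calc √(2 * π * RadData.tot φ * (δ ^ 4 * ∑ j ∈ Finset.range N, (((j:ℝ)+1) ^ 4 - (j:ℝ) ^ 4) * (π * ρ (j+1) ^ 2)))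
      ≤ √(2 * π * RadData.tot φ * ∫ x : E2, f ‖x‖ ^ 4) := by
        apply Real.sqrt_le_sqrt
        exact mul_le_mul_of_nonneg_left h4 (by positivity)
    _ = 2 * π * √(RadData.tot φ * ∫ r in (0:ℝ)..(ρ 0), r * f r ^ 4) := by
        rw [hrad 4 (by norm_num)]
        have : 2 * π * RadData.tot φ * (2 * π * ∫ r in (0:ℝ)..(ρ 0), r * f r ^ 4) =
          (2 * π) ^ 2 * (RadData.tot φ * ∫ r in (0:ℝ)..(ρ 0), r * f r ^ 4) := by ring
        rw [this, Real.sqrt_mul (by positivity), Real.sqrt_sq (by positivity)]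
    _ ≤ 2 * π * ((∫ r in (0:ℝ)..(ρ 0), r * f' r ^ 2) + ∫ r in (0:ℝ)..(ρ 0), r * f r ^ 2) := by gcongr
    _ = 2 * π * (∫ r in (0:ℝ)..(ρ 0), r * f' r ^ 2) + ∫ x : E2, f ‖x‖ ^ 2 := by
        rw [hrad 2 (by norm_num)]; ring
    _ ≤ _ := by
        refine add_le_add ?_ h2
        refine (mul_le_mul_of_nonneg_left hE (by positivity : 0 ≤ 2 * π)).trans (le_of_eq ?_)
        rw [Finset.mul_sum]
        apply Finset.sum_congr rfl
        intro j _
        rw [← div_div, div_right_comm]; ring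
end

section

lemma layer_term {a b A δ : ℝ} (hab : b ≤ a) (hb : 0 ≤ b) (hA : 0 ≤ A)
    (h : 4 * π * (π * b ^ 2) * δ ^ 2 ≤ A * (π * a ^ 2 - π * b ^ 2)) :
    π * δ ^ 2 * ((a + b) / (a - b)) ≤ A + 3 * π * δ ^ 2 := by
  have hpi := pi_pos
  rcases eq_or_lt_of_le hab with e | hlt
  · rw [e]; simp; positivity
  have h1 : 0 < a - b := by linarith
  have h2 : 0 < a + b := by linarith
  have h3 : 4 * π * b ^ 2 * δ ^ 2 ≤ A * (a ^ 2 - b ^ 2) := by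
    have : π * (4 * π * b ^ 2 * δ ^ 2) ≤ π * (A * (a ^ 2 - b ^ 2)) := by nlinarith
    exact le_of_mul_le_mul_left this hpi
  rw [← mul_div_assoc, div_le_iff₀ h1]
  have h4 : (a + b) * (π * δ ^ 2 * (a + b)) ≤ (a + b) * ((A + 3 * π * δ ^ 2) * (a - b)) := by
    have h5 : 0 ≤ π * δ ^ 2 * ((a - b) * a) := by
      have : 0 ≤ a := by linarith
      positivity
    nlinarith
  exact le_of_mul_le_mul_left h4 h2

lemma discrete_ineq {φ p : ℝ → ℝ} (h : RadData φ p) {u : E2 → ℝ} (hd : Differentiable ℝ u) (h0 : ∀ x, 0 ≤ u x)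
    {R : ℝ} (hs : ∀ x, u x ≠ 0 → ‖x‖ < R) (hg : Integrable (gradSq u)) {δ : ℝ} (hδ : 0 < δ) {N : ℕ} (hN : 0 < N) :
    √(2 * π * RadData.tot φ * ∫ x, (δ * cnt u δ 2 N x) ^ 4) ≤
      (∫ x, gradSq u x) + 3 * π * (δ ^ 2 * N) + ∫ x, u x ^ 2 := by
  have hpi := pi_pos
  have hgn : ∀ x, 0 ≤ gradSq u x := fun x => sq_nonneg _
  set ρ : ℕ → ℝ := fun j => √(dist2 u (((j:ℝ) + 1) * δ) / π) with hρ
  have hdn : ∀ t, 0 ≤ dist2 u t := fun t => measureReal_nonneg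
  have hρsq : ∀ j, π * ρ j ^ 2 = dist2 u (((j:ℝ) + 1) * δ) := by
    intro j
    simp only [hρ]
    rw [Real.sq_sqrt (div_nonneg (hdn _) hpi.le)]
    field_simp
  have hanti : Antitone ρ := by
    apply antitone_nat_of_succ_le
    intro j
    apply Real.sqrt_le_sqrt
    apply div_le_div_of_nonneg_right _ hpi.le
    apply measureReal_mono _ (cpt_fin hs (by positivity)).ne
    intro x hx
    simp only [Set.mem_ofPred_eq] at hx ⊢
    push_cast at hx
    nlinarith
  have hρ0 : ∀ j, 0 ≤ ρ j := fun j => Real.sqrt_nonneg _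
  set S : ℕ → Set E2 := fun j => {x | ((j:ℝ) + 1) * δ < u x ∧ u x ≤ (((j+1:ℕ):ℝ) + 1) * δ} with hS
  have hlay : ∀ j, 4 * π * (π * ρ (j+1) ^ 2) * δ ^ 2 ≤ (∫ x in S j, gradSq u x) * (π * ρ j ^ 2 - π * ρ (j+1) ^ 2) := by
    intro j
    have := layer hd hs hg (a := ((j:ℝ) + 1) * δ) (b := (((j+1:ℕ):ℝ) + 1) * δ) (by positivity)
      (by push_cast; nlinarith)
    rw [hρsq, hρsq]
    refine le_trans (le_of_eq ?_) this
    push_cast; ring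
  have hdeg : ∀ j, ρ j = ρ (j+1) → ρ (j+1) = 0 := by
    intro j e
    have := hlay j
    rw [e, sub_self, mul_zero] at this
    by_contra hne
    have : 0 < 4 * π * (π * ρ (j+1) ^ 2) * δ ^ 2 := by positivity
    linarith
  have hc4 := cnt_integral hd.continuous hs hδ 2 N (p := 4) (by norm_num)
  have hc2 := cnt_integral hd.continuous hs hδ 1 N (p := 2) (by norm_num)
  have e4 : ∫ x, (δ * cnt u δ 2 N x) ^ 4 =
      δ ^ 4 * ∑ j ∈ Finset.range N, (((j:ℝ)+1) ^ 4 - (j:ℝ) ^ 4) * (π * ρ (j+1) ^ 2) := by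
    simp_rw [mul_pow]
    rw [integral_const_mul, hc4.2]
    congr 1
    apply Finset.sum_congr rfl
    intro j _
    rw [hρsq]
    have : (((j:ℝ) + (2:ℕ)) * δ) = (((j+1:ℕ):ℝ) + 1) * δ := by push_cast; ring
    rw [this]
  have hu2 : Integrable (fun x => u x ^ 2) := by
    apply cpt_int (R := R) (hd.continuous.pow 2)
    intro x hx
    apply hs
    intro hh
    apply hx
    simp [hh]
  have e2 : δ ^ 2 * ∑ j ∈ Finset.range N, (((j:ℝ)+1) ^ 2 - (j:ℝ) ^ 2) * (π * ρ j ^ 2) ≤ ∫ x, u x ^ 2 := by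
    have : ∑ j ∈ Finset.range N, (((j:ℝ)+1) ^ 2 - (j:ℝ) ^ 2) * (π * ρ j ^ 2) = ∫ x, cnt u δ 1 N x ^ 2 := by
      rw [hc2.2]
      apply Finset.sum_congr rfl
      intro j _
      rw [hρsq]; push_cast; rfl
    rw [this, ← integral_const_mul]
    apply integral_mono (hc2.1.const_mul _) hu2
    intro x
    simp only
    rw [← mul_pow]
    exact pow_le_pow_left₀ (mul_nonneg hδ.le (cnt_nonneg _ _ _ _ _)) (cnt_le hδ le_rfl N (h0 x)) 2
  have hA0 : 0 ≤ ∫ x, gradSq u x := integral_nonneg hgn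
  have hB0 : 0 ≤ ∫ x, u x ^ 2 := integral_nonneg fun x => sq_nonneg _
  rcases (hρ0 0).eq_or_lt with hz | hpos
  · have : ∑ j ∈ Finset.range N, (((j:ℝ)+1) ^ 4 - (j:ℝ) ^ 4) * (π * ρ (j+1) ^ 2) = 0 := by
      apply Finset.sum_eq_zero
      intro j _
      have h1 : ρ (j+1) = 0 := le_antisymm ((hanti (Nat.zero_le _)).trans hz.symm.le) (hρ0 _)
      rw [h1]; simp
    rw [e4, this]
    simp only [mul_zero, Real.sqrt_zero]
    positivity
  have hp := profile h hanti hρ0 hdeg hpos hδ hN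
  rw [e4]
  refine hp.trans (add_le_add ?_ e2)
  have hSm : ∀ j, MeasurableSet (S j) := fun j =>
    ((isOpen_lt continuous_const hd.continuous).measurableSet).inter
      (isClosed_le hd.continuous continuous_const).measurableSet
  have hsumA : ∑ j ∈ Finset.range N, ∫ x in S j, gradSq u x ≤ ∫ x, gradSq u x := by
    rw [← integral_biUnion_finset _ (fun j _ => hSm j) _ (fun j _ => hg.integrableOn)]
    · exact setIntegral_le_integral hg (Eventually.of_forall hgn)
    · have key : ∀ i j : ℕ, i < j → Disjoint (S i) (S j) := by
        intro i j hij
        rw [Set.disjoint_left]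
        intro x hx hx'
        have h1 := hx.2
        have h2 := hx'.1
        have : ((i+1:ℕ):ℝ) ≤ (j:ℝ) := by exact_mod_cast hij
        nlinarith
      intro i _ j _ hij
      rcases lt_or_gt_of_ne hij with hh | hh
      · exact key i j hh
      · exact (key j i hh).symm
  calc ∑ j ∈ Finset.range N, π * δ ^ 2 * ((ρ j + ρ (j+1)) / (ρ j - ρ (j+1)))
      ≤ ∑ j ∈ Finset.range N, ((∫ x in S j, gradSq u x) + 3 * π * δ ^ 2) := by
        apply Finset.sum_le_sum
        intro j _
        exact layer_term (hanti (Nat.le_succ j)) (hρ0 _) (integral_nonneg fun x => hgn x) (hlay j)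
    _ = (∑ j ∈ Finset.range N, ∫ x in S j, gradSq u x) + 3 * π * (δ ^ 2 * N) := by
        rw [Finset.sum_add_distrib]; simp; ring
    _ ≤ _ := by linarith

/-- The sharp inequality for nonnegative compactly supported functions -/
theorem compact_ineq {φ p : ℝ → ℝ} (h : RadData φ p) {u : E2 → ℝ} (hd : Differentiable ℝ u) (h0 : ∀ x, 0 ≤ u x)
    {R : ℝ} (hs : ∀ x, u x ≠ 0 → ‖x‖ < R) (hg : Integrable (gradSq u)) :
    √(2 * π * RadData.tot φ * ∫ x, u x ^ 4) ≤ (∫ x, gradSq u x) + ∫ x, u x ^ 2 := by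
  have hi : Tendsto (fun i : ℕ => 1 / ((i:ℝ) + 1)) atTop (nhds 0) := tendsto_one_div_add_atTop_nhds_zero_nat
  set δ : ℕ → ℝ := fun i => (1 / ((i:ℝ) + 1)) ^ 2 with hδ
  set N : ℕ → ℕ := fun i => (i + 1) ^ 3 with hN
  have hδ0 : ∀ i, 0 < δ i := fun i => by simp only [hδ]; positivity
  have hδt : Tendsto δ atTop (nhds 0) := by
    have := hi.pow 2
    simpa only [ne_eq, OfNat.ofNat_ne_zero, not_false_eq_true, zero_pow] using this
  have hδN : ∀ i, δ i ^ 2 * (N i : ℝ) = 1 / ((i:ℝ) + 1) := by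
    intro i
    simp only [hδ, hN]
    push_cast
    field_simp
  have hNδ : ∀ i, (N i : ℝ) * δ i = (i:ℝ) + 1 := by
    intro i
    simp only [hδ, hN]
    push_cast
    field_simp
  have hu4 : Integrable (fun x => u x ^ 4) := by
    apply cpt_int (R := R) (hd.continuous.pow 4)
    intro x hx
    apply hs
    intro hh
    apply hx
    simp [hh]
  have hlim : Tendsto (fun i => ∫ x, (δ i * cnt u (δ i) 2 (N i) x) ^ 4) atTop (nhds (∫ x, u x ^ 4)) := by
    apply tendsto_integral_of_dominated_convergence (fun x => u x ^ 4) _ hu4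
    · intro i
      refine Eventually.of_forall fun x => ?_
      have h1 := mul_nonneg (hδ0 i).le (cnt_nonneg u (δ i) 2 (N i) x)
      rw [Real.norm_of_nonneg (pow_nonneg h1 4)]
      exact pow_le_pow_left₀ h1 (cnt_le (hδ0 i) (by norm_num) _ (h0 x)) 4
    · refine Eventually.of_forall fun x => ?_
      apply Tendsto.pow
      have hlow : Tendsto (fun i => u x - (2:ℕ) * δ i) atTop (nhds (u x)) := by
        have := (tendsto_const_nhds (x := u x)).sub (hδt.const_mul ((2:ℕ):ℝ))
        simpa using this
      refine tendsto_of_tendsto_of_tendsto_of_le_of_le' hlow tendsto_const_nhds ?_ ?_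
      · obtain ⟨k, hk⟩ := exists_nat_ge (u x)
        filter_upwards [eventually_ge_atTop k] with i hik
        have h1 := le_cnt (u := u) (hδ0 i) 2 (N i) (x := x)
        rw [min_eq_right] at h1
        · exact h1
        · rw [hNδ]
          have : (k:ℝ) ≤ i := by exact_mod_cast hik
          have := hδ0 i
          push_cast
          linarith
      · exact Eventually.of_forall fun i => cnt_le (hδ0 i) (by norm_num) _ (h0 x)
    · intro i
      have := (cnt_integral hd.continuous hs (hδ0 i) 2 (N i) (p := 4) (by norm_num)).1
      have := (this.const_mul ((δ i)^4)).aestronglyMeasurable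
      simpa only [mul_pow] using this
  have hL : Tendsto (fun i => √(2 * π * RadData.tot φ * ∫ x, (δ i * cnt u (δ i) 2 (N i) x) ^ 4)) atTop
      (nhds (√(2 * π * RadData.tot φ * ∫ x, u x ^ 4))) := (hlim.const_mul _).sqrt
  have hRr : Tendsto (fun i : ℕ => (∫ x, gradSq u x) + 3 * π * (1 / ((i:ℝ) + 1)) + ∫ x, u x ^ 2) atTop
      (nhds ((∫ x, gradSq u x) + 3 * π * 0 + ∫ x, u x ^ 2)) :=
    (tendsto_const_nhds.add (hi.const_mul _)).add tendsto_const_nhds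
  have := le_of_tendsto_of_tendsto' hL hRr (fun i => by
    have := discrete_ineq h hd h0 hs hg (hδ0 i) (N := N i) (by simp only [hN]; positivity)
    rw [hδN] at this
    exact this)
  simpa using this
end

section

lemma exists_cutoff : ∃ (χ : E2 → ℝ) (C : ℝ), 0 ≤ C ∧ Differentiable ℝ χ ∧ (∀ x, 0 ≤ χ x) ∧ (∀ x, χ x ≤ 1) ∧
    (∀ x, ‖x‖ ≤ 1 → χ x = 1) ∧ (∀ x, χ x ≠ 0 → ‖x‖ < 2) ∧ ∀ x, ‖fderiv ℝ χ x‖ ≤ C := by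
  let f : ContDiffBump (0:E2) := ⟨1, 2, one_pos, by norm_num⟩
  have hC : ContDiff ℝ 1 (f : E2 → ℝ) := f.contDiff
  have hcs : HasCompactSupport (fderiv ℝ (f : E2 → ℝ)) := f.hasCompactSupport.fderiv ℝ
  obtain ⟨C, hb⟩ := hcs.exists_bound_of_continuous (hC.continuous_fderiv (by norm_num))
  refine ⟨f, C, (norm_nonneg _).trans (hb 0), hC.differentiable (by norm_num), fun x => f.nonneg, fun x => f.le_one, ?_, ?_, hb⟩
  · intro x hx
    apply f.one_of_mem_closedBall
    simpa using hx
  · intro x hx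
    by_contra h
    apply hx
    apply f.zero_of_le_dist
    simp only [dist_zero_right]
    exact not_lt.1 h

lemma fderiv_scale {u : E2 → ℝ} (hd : Differentiable ℝ u) (c : ℝ) (x : E2) :
    HasFDerivAt (fun x => u (c • x)) (c • fderiv ℝ u (c • x)) x := by
  have h1 : HasFDerivAt (fun x : E2 => c • x) (c • ContinuousLinearMap.id ℝ E2) x :=
    (hasFDerivAt_id x).const_smul c
  have := (hd (c • x)).hasFDerivAt.comp x h1
  refine this.congr_fderiv ?_
  ext v; simp

/-- The non scale-invariant inequality, general functions -/
theorem h1_ineq {φ p : ℝ → ℝ} (h : RadData φ p) {u : E2 → ℝ} (hu : IsH1 u) :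
    √(2 * π * RadData.tot φ * ∫ x, u x ^ 4) ≤ (∫ x, gradSq u x) + ∫ x, u x ^ 2 := by
  obtain ⟨hd, hi2, hig, hi4⟩ := hu
  obtain ⟨χ, C, hC0, hχd, hχ0, hχ1, hχone, hχs, hχb⟩ := exists_cutoff
  have hi : Tendsto (fun i : ℕ => 1 / ((i:ℝ) + 1)) atTop (nhds 0) := tendsto_one_div_add_atTop_nhds_zero_nat
  set e : ℕ → ℝ := fun i => 1 / ((i:ℝ) + 1) with he
  have he0 : ∀ i, 0 < e i := fun i => by simp only [he]; positivity
  set w : ℕ → E2 → ℝ := fun i x => √(u x ^ 2 + e i ^ 2) - e i with hw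
  have hpos : ∀ i x, 0 < u x ^ 2 + e i ^ 2 := fun i x => by have := he0 i; positivity
  have hw0 : ∀ i x, 0 ≤ w i x := by
    intro i x
    simp only [hw, sub_nonneg]
    apply Real.le_sqrt_of_sq_le
    nlinarith [sq_nonneg (u x)]
  have hw1 : ∀ i x, w i x ≤ |u x| := by
    intro i x
    simp only [hw]
    rw [sub_le_iff_le_add, Real.sqrt_le_left (add_nonneg (abs_nonneg _) (he0 i).le)]
    have := sq_abs (u x)
    nlinarith [mul_nonneg (abs_nonneg (u x)) (he0 i).le]
  have hwd : ∀ i x, HasFDerivAt (w i) ((u x / √(u x ^ 2 + e i ^ 2)) • fderiv ℝ u x) x := by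
    intro i x
    have h1 : HasDerivAt (fun s : ℝ => √(s ^ 2 + e i ^ 2) - e i) (u x / √(u x ^ 2 + e i ^ 2)) (u x) := by
      have := (((hasDerivAt_pow 2 (u x)).add_const (e i ^ 2)).sqrt (hpos i x).ne').sub_const (e i)
      refine this.congr_deriv ?_
      have := Real.sqrt_pos.2 (hpos i x)
      push_cast
      field_simp
    exact h1.comp_hasFDerivAt x (hd x).hasFDerivAt
  have hwdb : ∀ i x, ‖(u x / √(u x ^ 2 + e i ^ 2)) • fderiv ℝ u x‖ ≤ ‖fderiv ℝ u x‖ := by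
    intro i x
    rw [norm_smul]
    apply mul_le_of_le_one_left (norm_nonneg _)
    have hs := Real.sqrt_pos.2 (hpos i x)
    rw [Real.norm_eq_abs, abs_div, abs_of_pos hs, div_le_one hs]
    apply Real.le_sqrt_of_sq_le
    rw [sq_abs]
    nlinarith [sq_nonneg (e i)]
  set v : ℕ → E2 → ℝ := fun i x => χ (e i • x) * w i x with hv
  have hvd : ∀ i x, HasFDerivAt (v i) (χ (e i • x) • ((u x / √(u x ^ 2 + e i ^ 2)) • fderiv ℝ u x)
      + w i x • (e i • fderiv ℝ χ (e i • x))) x := fun i x =>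
    (fderiv_scale hχd (e i) x).mul (hwd i x)
  have hv0 : ∀ i x, 0 ≤ v i x := fun i x => mul_nonneg (hχ0 _) (hw0 i x)
  have hv1 : ∀ i x, v i x ≤ |u x| := fun i x =>
    (mul_le_of_le_one_left (hw0 i x) (hχ1 _)).trans (hw1 i x)
  have hvs : ∀ i x, v i x ≠ 0 → ‖x‖ < 2 / e i := by
    intro i x hx
    have := hχs _ (left_ne_zero_of_mul hx)
    rw [norm_smul, Real.norm_of_nonneg (he0 i).le] at this
    rw [lt_div_iff₀ (he0 i)]; linarith
  have hvg : ∀ i x, gradSq (v i) x ≤ (1 + e i) * gradSq u x + (1 + 1 / e i) * (C * e i) ^ 2 * u x ^ 2 := by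
    intro i x
    have h1 : ‖fderiv ℝ (v i) x‖ ≤ ‖fderiv ℝ u x‖ + |u x| * (C * e i) := by
      rw [(hvd i x).fderiv]
      refine (norm_add_le _ _).trans (add_le_add ?_ ?_)
      · rw [norm_smul, Real.norm_of_nonneg (hχ0 _)]
        exact (mul_le_of_le_one_left (norm_nonneg _) (hχ1 _)).trans (hwdb i x)
      · rw [norm_smul, norm_smul, Real.norm_of_nonneg (hw0 i x), Real.norm_of_nonneg (he0 i).le, mul_comm C]
        have := hχb (e i • x)
        have := he0 i
        have := hw1 i x
        gcongr
    have h2 := pow_le_pow_left₀ (norm_nonneg _) h1 2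
    rw [gradSq, gradSq]
    refine h2.trans ?_
    set a := ‖fderiv ℝ u x‖
    set b := |u x| * (C * e i)
    have hb : (1 + 1 / e i) * (C * e i) ^ 2 * u x ^ 2 = (1 + 1 / e i) * b ^ 2 := by
      simp only [b]; rw [mul_pow |u x|, sq_abs]; ring
    rw [hb]
    have hei := he0 i
    have : (1 + e i) * a ^ 2 + (1 + 1 / e i) * b ^ 2 - (a + b) ^ 2 = (e i * a - b) ^ 2 / e i := by
      field_simp; ring
    have h3 : 0 ≤ (e i * a - b) ^ 2 / e i := by positivity
    linarith
  have hbi : ∀ i, Integrable (fun x => (1 + e i) * gradSq u x + (1 + 1 / e i) * (C * e i) ^ 2 * u x ^ 2) :=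
    fun i => (hig.const_mul _).add (hi2.const_mul _)
  have hvdiff : ∀ i, Differentiable ℝ (v i) := fun i x => (hvd i x).differentiableAt
  have hvgi : ∀ i, Integrable (gradSq (v i)) := by
    intro i
    refine (hbi i).mono' ((measurable_fderiv ℝ (v i)).norm.pow_const 2).aestronglyMeasurable
      (Eventually.of_forall fun x => ?_)
    rw [Real.norm_of_nonneg (by exact sq_nonneg _)]
    exact hvg i x
  have hA : ∀ i, ∫ x, gradSq (v i) x ≤ (1 + e i) * (∫ x, gradSq u x) + (C ^ 2 * (e i ^ 2 + e i)) * ∫ x, u x ^ 2 := by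
    intro i
    refine (integral_mono (hvgi i) (hbi i) (hvg i)).trans (le_of_eq ?_)
    rw [integral_add (hig.const_mul _) (hi2.const_mul _), integral_const_mul, integral_const_mul]
    have := he0 i
    congr 2
    field_simp
  have hB : ∀ i, ∫ x, v i x ^ 2 ≤ ∫ x, u x ^ 2 := by
    intro i
    apply integral_mono_of_nonneg (Eventually.of_forall fun x => sq_nonneg _) hi2
    refine Eventually.of_forall fun x => ?_
    simp only
    rw [← sq_abs (u x)]
    exact pow_le_pow_left₀ (hv0 i x) (hv1 i x) 2
  have hlim : Tendsto (fun i => ∫ x, v i x ^ 4) atTop (nhds (∫ x, u x ^ 4)) := by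
    apply tendsto_integral_of_dominated_convergence (fun x => u x ^ 4) _ hi4
    · intro i
      refine Eventually.of_forall fun x => ?_
      rw [Real.norm_of_nonneg (pow_nonneg (hv0 i x) 4), ← Even.pow_abs (by decide : Even 4) (u x)]
      exact pow_le_pow_left₀ (hv0 i x) (hv1 i x) 4
    · refine Eventually.of_forall fun x => ?_
      rw [← Even.pow_abs (by decide : Even 4) (u x)]
      apply Tendsto.pow
      have hwt : Tendsto (fun i => w i x) atTop (nhds |u x|) := by
        have hcont : Continuous (fun s : ℝ => √(u x ^ 2 + s ^ 2) - s) := by fun_prop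
        have := (hcont.tendsto 0).comp hi
        have e0 : √(u x ^ 2 + 0 ^ 2) - 0 = |u x| := by simp [Real.sqrt_sq_eq_abs]
        rw [e0] at this
        exact this
      refine hwt.congr' ?_
      have hei : Tendsto (fun i => e i * ‖x‖) atTop (nhds 0) := by
        simpa using hi.mul_const ‖x‖
      filter_upwards [hei.eventually_le_const one_pos] with i hix
      have : χ (e i • x) = 1 := by
        apply hχone
        rw [norm_smul, Real.norm_of_nonneg (he0 i).le]; exact hix
      simp only [hv]
      rw [this, one_mul]
    · intro i
      exact ((hvdiff i).continuous.pow 4).aestronglyMeasurable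
  have hL : Tendsto (fun i => √(2 * π * RadData.tot φ * ∫ x, v i x ^ 4)) atTop
      (nhds (√(2 * π * RadData.tot φ * ∫ x, u x ^ 4))) := (hlim.const_mul _).sqrt
  have hcont : Continuous (fun s : ℝ => (1 + s) * (∫ x, gradSq u x) + (C ^ 2 * (s ^ 2 + s)) * (∫ x, u x ^ 2)
      + ∫ x, u x ^ 2) := by fun_prop
  have hRr := (hcont.tendsto 0).comp hi
  have := le_of_tendsto_of_tendsto' hL hRr (fun i => by
    have h1 := compact_ineq h (hvdiff i) (hv0 i) (hvs i) (hvgi i)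
    have h2 := hA i
    have h3 := hB i
    simp only [Function.comp]
    linarith)
  simpa using this

lemma h1_scale {u : E2 → ℝ} (hu : IsH1 u) {μ : ℝ} (hμ : 0 < μ) : IsH1 (fun x => u (μ • x)) ∧
    (∫ x, gradSq (fun x => u (μ • x)) x) = ∫ x, gradSq u x := by
  obtain ⟨hd, hi2, hig, hi4⟩ := hu
  have e : gradSq (fun x => u (μ • x)) = fun x => μ ^ 2 * gradSq u (μ • x) := by
    funext x
    rw [gradSq, (fderiv_scale hd μ x).fderiv, norm_smul, mul_pow, Real.norm_of_nonneg hμ.le, gradSq]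
  refine ⟨⟨fun x => (fderiv_scale hd μ x).differentiableAt, hi2.comp_smul hμ.ne', ?_, hi4.comp_smul hμ.ne'⟩, ?_⟩
  · rw [e]; exact (hig.comp_smul hμ.ne').const_mul _
  · rw [e, integral_const_mul, Measure.integral_comp_smul]
    simp
    field_simp

theorem gn_main {φ p : ℝ → ℝ} (h : RadData φ p) {u : E2 → ℝ} (hu : IsH1 u) :
    2 * π * RadData.tot φ * (∫ x, u x ^ 4) ≤ 4 * ((∫ x, gradSq u x) * ∫ x, u x ^ 2) := by
  set A := ∫ x, gradSq u x with hA
  set B := ∫ x, u x ^ 2 with hB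
  set D := ∫ x, u x ^ 4 with hD
  have hA0 : 0 ≤ A := integral_nonneg fun x => sq_nonneg _
  have hB0 : 0 ≤ B := integral_nonneg fun x => sq_nonneg _
  have hD0 : 0 ≤ D := integral_nonneg fun x => by positivity
  have hM : 0 ≤ 2 * π * RadData.tot φ := by have := h.tot_pos; have := pi_pos; positivity
  have key : ∀ μ : ℝ, 0 ≤ A * (μ * μ) + (-√(2 * π * RadData.tot φ * D)) * μ + B := by
    intro μ
    rcases le_or_gt μ 0 with hμ | hμ
    · have := Real.sqrt_nonneg (2 * π * RadData.tot φ * D)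
      have h1 := mul_nonneg hA0 (mul_self_nonneg μ)
      nlinarith
    · have h1 := h1_ineq h (h1_scale hu hμ).1
      rw [(h1_scale hu hμ).2] at h1
      have e2 : ∫ x, u (μ • x) ^ 2 = B / μ ^ 2 := by
        rw [Measure.integral_comp_smul (volume : Measure E2) (fun x => u x ^ 2) μ]
        simp [hB]
        field_simp
      have e4 : ∫ x, u (μ • x) ^ 4 = D / μ ^ 2 := by
        rw [Measure.integral_comp_smul (volume : Measure E2) (fun x => u x ^ 4) μ]
        simp [hD]
        field_simp
      rw [e2, e4, ← mul_div_assoc, Real.sqrt_div' _ (sq_nonneg μ), Real.sqrt_sq hμ.le] at h1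
      have h2 := mul_le_mul_of_nonneg_left h1 (sq_nonneg μ)
      have e5 : μ ^ 2 * (√(2 * π * RadData.tot φ * D) / μ) = √(2 * π * RadData.tot φ * D) * μ := by
        field_simp
      have e6 : μ ^ 2 * (A + B / μ ^ 2) = A * (μ * μ) + B := by
        field_simp
      rw [e5] at h2
      rw [← hA, e6] at h2
      linarith
  have := discrim_le_zero key
  rw [discrim, neg_sq, Real.sq_sqrt (mul_nonneg hM hD0)] at this
  linarith
end

theorem stmt2 (Q : E2 → ℝ) (hQ : IsGroundState Q) (u : E2 → ℝ) (hu : IsH1 u) :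
    ((0 < ∫ x : E2, u x ^ 4) →
      (∫ x : E2, Q x ^ 2) ≤
        2 * ((∫ x : E2, gradSq u x) * (∫ x : E2, u x ^ 2)) / (∫ x : E2, u x ^ 4)) ∧
    (∫ x : E2, u x ^ 4) ≤
      2 / (∫ x : E2, Q x ^ 2) * (∫ x : E2, gradSq u x) * (∫ x : E2, u x ^ 2) := by
  obtain ⟨φ, p, h, h4, h2⟩ := groundState_data hQ
  have hg := gn_main h hu
  have ht := h.tot_pos
  have hq : 0 < ∫ x : E2, Q x ^ 2 := by
    have : 0 < 2 * π * RadData.tot φ := mul_pos Real.two_pi_pos ht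
    linarith
  rw [← h4, h2] at hg
  constructor
  · intro hu4
    rw [le_div_iff₀ hu4]
    nlinarith
  · rw [div_mul_eq_mul_div, div_mul_eq_mul_div, le_div_iff₀ hq]
    nlinarith
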